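/- arXiv:2411.01452 — 3 statements merged into one kernel-verified Lean document; each statement's English description precedes it below -/
import Mathlib

section
/- Let z = (z_1,…,z_b) be a configuration of length b over operators in ℰ ∪ ℰ_F ∪ 𝒱, let i ∈ 𝒱, let j ∈ {1,…,b+1}, and let z' = (z_1,…,z_{j−1}, i, z_j,…,z_b) be the configuration of length b+1 obtained by inserting the vertex operator at site i in position j. Call a vertex of G_z an endpoint vertex if it is a boundary vertex (time coordinate 0 or b) or has the form (k,t−1) or (k,t) with z_t = k ∈ 𝒱. Then: if the connected component of G_z containing the vertex (i, j−1) contains no endpoint vertex (a closed loop), L(z') = L(z); otherwise L(z') = L(z) + 1. -/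
open SimpleGraph

variable {V : Type*}

/-- The relation generating the strand graph of a configuration `x` of `n` local
operators (each operator is a finite set of sites: an AFM edge in `E`, an FM edge
in `EF`, or a singleton vertex operator). -/
def strandRel (E EF : Finset (Finset V)) (n : ℕ) (x : Fin n → Finset V)
    (p q : V × Fin (n + 1)) : Prop :=
  ∃ t : Fin n,
    -- temporal edge at a site the operator does not act on
    (p.1 = q.1 ∧ p.1 ∉ x t ∧ p.2 = Fin.castSucc t ∧ q.2 = Fin.succ t) ∨
    -- bridge edges of an antiferromagnetic operator
    (x t ∈ E ∧ p.1 ∈ x t ∧ q.1 ∈ x t ∧ p.1 ≠ q.1 ∧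
      ((p.2 = Fin.castSucc t ∧ q.2 = Fin.castSucc t) ∨
       (p.2 = Fin.succ t ∧ q.2 = Fin.succ t))) ∨
    -- crossing edges of a ferromagnetic operator
    (x t ∈ EF ∧ p.1 ∈ x t ∧ q.1 ∈ x t ∧ p.1 ≠ q.1 ∧
      p.2 = Fin.castSucc t ∧ q.2 = Fin.succ t)

/-- The strand graph of a configuration. -/
def strandGraph (E EF : Finset (Finset V)) (n : ℕ) (x : Fin n → Finset V) :
    SimpleGraph (V × Fin (n + 1)) :=
  SimpleGraph.fromRel (strandRel E EF n x)

/-- `L(x)`: the number of loops (connected components of the strand graph). -/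
noncomputable def numLoops (E EF : Finset (Finset V)) (n : ℕ) (x : Fin n → Finset V) : ℕ :=
  Nat.card (strandGraph E EF n x).ConnectedComponent

/-- The number of loops of a configuration given as a list of operators. -/
noncomputable def numLoopsL (E EF : Finset (Finset V)) (l : List (Finset V)) : ℕ :=
  numLoops E EF l.length l.get

/-- An endpoint vertex of the strand graph of a list configuration `z`: a boundary
vertex (time coordinate `0` or `z.length`) or a vertex `(k, t−1)` or `(k, t)` where
the `t`-th operator is the vertex operator at site `k`. -/
def isEndpoint (z : List (Finset V)) (v : V × Fin (z.length + 1)) : Prop :=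
  (v.2 : ℕ) = 0 ∨ (v.2 : ℕ) = z.length ∨
    ∃ t : Fin z.length, z.get t = ({v.1} : Finset V) ∧
      ((v.2 : ℕ) = (t : ℕ) ∨ (v.2 : ℕ) = (t : ℕ) + 1)

/-- The vertex `s` is reachable from `d` along a partial injection `N`, when `d` has no predecessor and
every vertex reachable from `d` other than `s` has a successor. -/
theorem Relation.ReflTransGen.of_exists_succ {X : Type*} [Finite X] {N : X → X → Prop}
    (hinj : ∀ a b c, N a c → N b c → a = b) {s d : X} (hd : ∀ a, ¬ N a d)
    (hout : ∀ a, Relation.ReflTransGen N d a → a ≠ s → ∃ b, N a b) :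
    Relation.ReflTransGen N d s := by
  by_contra hs
  have hex : ∀ a : {a // Relation.ReflTransGen N d a},
      ∃ b : {a // Relation.ReflTransGen N d a}, N a b := by
    rintro ⟨a, ha⟩
    obtain ⟨b, hb⟩ := hout a ha (by rintro rfl; exact hs ha)
    exact ⟨⟨b, ha.tail hb⟩, hb⟩
  choose f hf using hex
  have hfi : Function.Injective f := fun a b h =>
    Subtype.ext (hinj _ _ _ (hf a) (h ▸ hf b))
  obtain ⟨c, hc⟩ := Finite.surjective_of_injective hfi ⟨d, .refl⟩
  exact hd c (by simpa [hc] using hf c)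

namespace SimpleGraph

theorem Reachable.of_reflTransGen {X : Type*} {H : SimpleGraph X} {N : X → X → Prop}
    (hN : ∀ a b, N a b → H.Adj a b) {a b : X} (h : Relation.ReflTransGen N a b) :
    H.Reachable a b := by
  induction h with
  | refl => rfl
  | tail _ h ih => exact ih.trans (hN _ _ h).reachable

/-- If `H` is the underlying graph of a partial injection `N`, the component of a vertex `d`
without predecessor is the forward orbit of `d`. -/
theorem Reachable.reflTransGen {X : Type*} {H : SimpleGraph X} {N : X → X → Prop}
    (hN : ∀ a b, H.Adj a b → N a b ∨ N b a) (hinj : ∀ a b c, N a c → N b c → a = b)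
    {d : X} (hd : ∀ a, ¬ N a d) {a : X} (h : H.Reachable d a) :
    Relation.ReflTransGen N d a := by
  rw [reachable_iff_reflTransGen] at h
  induction h with
  | refl => rfl
  | tail _ h ih =>
    rcases hN _ _ h with h | h
    · exact ih.tail h
    · rcases Relation.ReflTransGen.cases_tail ih with rfl | ⟨c, hc, hcb⟩
      · exact absurd h (hd _)
      · exact hinj _ _ _ hcb h ▸ hc

/-- `φ` exhibits `G` as the graph obtained from `H` by contracting edges of `H` and identifying
the vertices `s` and `d`. -/
structure IsGluing {X Y : Type*} (H : SimpleGraph X) (G : SimpleGraph Y) (φ : X → Y)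
    (s d : X) : Prop where
  surj : Function.Surjective φ
  map_eq : φ s = φ d
  map_adj : ∀ a b, H.Adj a b → φ a = φ b ∨ G.Adj (φ a) (φ b)
  lift_adj : ∀ p q, G.Adj p q → ∃ a b, φ a = p ∧ φ b = q ∧ H.Adj a b
  fiber : ∀ a b, φ a = φ b → a = b ∨ H.Adj a b ∨ (a = s ∧ b = d) ∨ (a = d ∧ b = s)

namespace IsGluing

variable {X Y : Type*} {H : SimpleGraph X} {G : SimpleGraph Y} {φ : X → Y} {s d : X}

theorem reachable_map (h : IsGluing H G φ s d) {a b : X} (hab : H.Reachable a b) :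
    G.Reachable (φ a) (φ b) := by
  rw [reachable_iff_reflTransGen] at hab
  induction hab with
  | refl => rfl
  | tail _ hbc ih =>
    rcases h.map_adj _ _ hbc with e | e
    · exact e ▸ ih
    · exact ih.trans e.reachable

theorem reachable_fiber (h : IsGluing H G φ s d) {a b : X} (hab : φ a = φ b) :
    H.Reachable a b ∨ (H.Reachable a s ∧ H.Reachable d b) ∨
      (H.Reachable a d ∧ H.Reachable s b) := by
  rcases h.fiber a b hab with rfl | e | ⟨rfl, rfl⟩ | ⟨rfl, rfl⟩
  · exact .inl .rfl
  · exact .inl e.reachable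
  · exact .inr (.inl ⟨.rfl, .rfl⟩)
  · exact .inr (.inr ⟨.rfl, .rfl⟩)

theorem reachable_lift (h : IsGluing H G φ s d) {p q : Y} (hpq : G.Reachable p q) :
    ∀ a b, φ a = p → φ b = q → H.Reachable a b ∨ (H.Reachable a s ∧ H.Reachable d b) ∨
      (H.Reachable a d ∧ H.Reachable s b) := by
  have trans : ∀ {a b c : X},
      (H.Reachable a b ∨ (H.Reachable a s ∧ H.Reachable d b) ∨
        (H.Reachable a d ∧ H.Reachable s b)) →
      (H.Reachable b c ∨ (H.Reachable b s ∧ H.Reachable d c) ∨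
        (H.Reachable b d ∧ H.Reachable s c)) →
      (H.Reachable a c ∨ (H.Reachable a s ∧ H.Reachable d c) ∨
        (H.Reachable a d ∧ H.Reachable s c)) := by
    rintro a b c (h1 | ⟨h1, h2⟩ | ⟨h1, h2⟩) (h3 | ⟨h3, h4⟩ | ⟨h3, h4⟩)
    · exact .inl (h1.trans h3)
    · exact .inr (.inl ⟨h1.trans h3, h4⟩)
    · exact .inr (.inr ⟨h1.trans h3, h4⟩)
    · exact .inr (.inl ⟨h1, h2.trans h3⟩)
    · exact .inr (.inl ⟨h1, h4⟩)
    · exact .inl (h1.trans h4)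
    · exact .inr (.inr ⟨h1, h2.trans h3⟩)
    · exact .inl (h1.trans h4)
    · exact .inr (.inr ⟨h1, h4⟩)
  rw [reachable_iff_reflTransGen] at hpq
  induction hpq with
  | refl => exact fun a b ha hb => h.reachable_fiber (ha.trans hb.symm)
  | tail _ hqr ih =>
    intro a c ha hc
    obtain ⟨a', c', ha', hc', hadj⟩ := h.lift_adj _ _ hqr
    exact trans (trans (ih a a' ha ha') (.inl hadj.reachable))
      (h.reachable_fiber (hc'.trans hc.symm))

/-- The map on connected components induced by a gluing. -/
def mapComponent (h : IsGluing H G φ s d) : H.ConnectedComponent → G.ConnectedComponent :=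
  Quot.map φ fun _ _ hab => h.reachable_map hab

theorem mapComponent_mk (h : IsGluing H G φ s d) (a : X) :
    h.mapComponent (H.connectedComponentMk a) = G.connectedComponentMk (φ a) := rfl

theorem mapComponent_surjective (h : IsGluing H G φ s d) :
    Function.Surjective h.mapComponent := by
  intro c
  induction c using ConnectedComponent.ind with | _ p =>
  obtain ⟨a, rfl⟩ := h.surj p
  exact ⟨H.connectedComponentMk a, rfl⟩

theorem card_eq_of_reachable (h : IsGluing H G φ s d) (hsd : H.Reachable s d) :
    Nat.card H.ConnectedComponent = Nat.card G.ConnectedComponent := by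
  refine Nat.card_eq_of_bijective h.mapComponent ⟨?_, h.mapComponent_surjective⟩
  intro c c' hcc
  induction c using ConnectedComponent.ind with | _ a =>
  induction c' using ConnectedComponent.ind with | _ b =>
  rw [mapComponent_mk, mapComponent_mk, ConnectedComponent.eq] at hcc
  rw [ConnectedComponent.eq]
  rcases h.reachable_lift hcc a b rfl rfl with e | ⟨e, f⟩ | ⟨e, f⟩
  · exact e
  · exact (e.trans hsd).trans f
  · exact (e.trans hsd.symm).trans f

theorem card_eq_of_not_reachable [Finite X] (h : IsGluing H G φ s d)
    (hsd : ¬ H.Reachable s d) :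
    Nat.card H.ConnectedComponent = Nat.card G.ConnectedComponent + 1 := by
  classical
  have : Finite H.ConnectedComponent := Quot.finite _
  have hcard : Nat.card {c // c ≠ H.connectedComponentMk s} = Nat.card G.ConnectedComponent := by
    refine Nat.card_eq_of_bijective (fun c => h.mapComponent c.1) ⟨?_, ?_⟩
    · rintro ⟨c, hc⟩ ⟨c', hc'⟩ hcc
      induction c using ConnectedComponent.ind with | _ a =>
      induction c' using ConnectedComponent.ind with | _ b =>
      simp only [mapComponent_mk, ConnectedComponent.eq] at hcc
      rw [ne_eq, ConnectedComponent.eq] at hc hc'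
      rw [Subtype.mk.injEq, ConnectedComponent.eq]
      rcases h.reachable_lift hcc a b rfl rfl with e | ⟨e, -⟩ | ⟨-, f⟩
      · exact e
      · exact absurd e hc
      · exact absurd f.symm hc'
    · intro c
      obtain ⟨c, rfl⟩ := h.mapComponent_surjective c
      by_cases hc : c = H.connectedComponentMk s
      · refine ⟨⟨H.connectedComponentMk d, fun e => hsd (ConnectedComponent.eq.1 e).symm⟩, ?_⟩
        rw [hc]
        simp only [mapComponent_mk, h.map_eq]
      · exact ⟨⟨c, hc⟩, rfl⟩
  rw [← hcard, ← Finite.card_option]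
  exact Nat.card_congr (Equiv.optionSubtypeNe _).symm

end IsGluing

end SimpleGraph

/-- Level at which the strand through site `k`, oriented upwards on `A` and downwards off `A`,
enters slot `t`. -/
def enterLevel [DecidableEq V] (A : Finset V) {n : ℕ} (t : Fin n) (k : V) : Fin (n + 1) :=
  if k ∈ A then t.castSucc else t.succ

/-- Level at which the strand through site `k`, oriented upwards on `A` and downwards off `A`,
leaves slot `t`. -/
def leaveLevel [DecidableEq V] (A : Finset V) {n : ℕ} (t : Fin n) (k : V) : Fin (n + 1) :=
  if k ∈ A then t.succ else t.castSucc

/-- The operator `e` connects the strand entering at site `k` to the one leaving at site `l`. -/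
def opConnects (E EF : Finset (Finset V)) (e : Finset V) (k l : V) : Prop :=
  (k = l ∧ k ∉ e) ∨ ((e ∈ E ∨ e ∈ EF) ∧ k ∈ e ∧ l ∈ e ∧ k ≠ l)

theorem opConnects.symm {E EF : Finset (Finset V)} {e : Finset V} {k l : V}
    (h : opConnects E EF e k l) : opConnects E EF e l k := by
  rcases h with ⟨rfl, h⟩ | ⟨h, hk, hl, hkl⟩
  · exact .inl ⟨rfl, h⟩
  · exact .inr ⟨h, hl, hk, hkl.symm⟩

theorem not_opConnects_singleton {E EF : Finset (Finset V)}
    (hcard : ∀ e, e ∈ E ∨ e ∈ EF → e.card = 2) (k l : V) :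
    ¬ opConnects E EF {k} k l := by
  rintro (⟨-, h⟩ | ⟨h, -⟩)
  · simp at h
  · simpa using hcard _ h

/-- The oriented edges of the strand graph. -/
def strandNext [DecidableEq V] (A : Finset V) (E EF : Finset (Finset V)) {n : ℕ}
    (x : Fin n → Finset V) (p q : V × Fin (n + 1)) : Prop :=
  ∃ t : Fin n, p.2 = enterLevel A t p.1 ∧ q.2 = leaveLevel A t q.1 ∧
    opConnects E EF (x t) p.1 q.1

section Strand

variable [DecidableEq V] {A : Finset V} {E EF : Finset (Finset V)}

theorem enterLevel_injective (k : V) {n : ℕ} {t t' : Fin n}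
    (h : enterLevel A t k = enterLevel A t' k) : t = t' := by
  unfold enterLevel at h
  split_ifs at h
  · exact Fin.castSucc_injective _ h
  · exact Fin.succ_injective _ h

theorem leaveLevel_injective (k : V) {n : ℕ} {t t' : Fin n}
    (h : leaveLevel A t k = leaveLevel A t' k) : t = t' := by
  unfold leaveLevel at h
  split_ifs at h
  · exact Fin.succ_injective _ h
  · exact Fin.castSucc_injective _ h

theorem opConnects.unique (hcard : ∀ e, e ∈ E ∨ e ∈ EF → e.card = 2)
    {e : Finset V} {k l l' : V} (h : opConnects E EF e k l) (h' : opConnects E EF e k l') :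
    l = l' := by
  rcases h with ⟨rfl, h⟩ | ⟨h, hk, hl, hkl⟩ <;> rcases h' with ⟨rfl, h'⟩ | ⟨h', hk', hl', hkl'⟩
  · rfl
  · exact absurd hk' h
  · exact absurd hk h'
  · obtain ⟨a, b, -, rfl⟩ := Finset.card_eq_two.1 (hcard e h)
    simp only [Finset.mem_insert, Finset.mem_singleton] at *
    grind

theorem exists_opConnects (hcard : ∀ e, e ∈ E ∨ e ∈ EF → e.card = 2)
    {e : Finset V} (he : e ∈ E ∪ EF ∨ ∃ k : V, e = {k}) {k : V} (hk : e ≠ {k}) :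
    ∃ l, opConnects E EF e k l := by
  by_cases hke : k ∈ e
  · rcases he with he | ⟨l, rfl⟩
    · rw [Finset.mem_union] at he
      obtain ⟨l, hl, hlk⟩ := Finset.exists_mem_ne (by rw [hcard e he]; norm_num) k
      exact ⟨l, .inr ⟨he, hke, hl, hlk.symm⟩⟩
    · rw [Finset.mem_singleton] at hke
      exact absurd (by rw [hke]) hk
  · exact ⟨k, .inl ⟨rfl, hke⟩⟩

theorem strandNext.right_unique (hcard : ∀ e, e ∈ E ∨ e ∈ EF → e.card = 2) {n : ℕ}
    {x : Fin n → Finset V} {p q q' : V × Fin (n + 1)} (h : strandNext A E EF x p q)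
    (h' : strandNext A E EF x p q') : q = q' := by
  obtain ⟨t, h1, h2, h3⟩ := h
  obtain ⟨t', h1', h2', h3'⟩ := h'
  obtain rfl := enterLevel_injective _ (h1.symm.trans h1')
  have := h3.unique hcard h3'
  exact Prod.ext this (by rw [h2, h2', this])

theorem strandNext.left_unique (hcard : ∀ e, e ∈ E ∨ e ∈ EF → e.card = 2) {n : ℕ}
    {x : Fin n → Finset V} {p p' q : V × Fin (n + 1)} (h : strandNext A E EF x p q)
    (h' : strandNext A E EF x p' q) : p = p' := by
  obtain ⟨t, h1, h2, h3⟩ := h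
  obtain ⟨t', h1', h2', h3'⟩ := h'
  obtain rfl := leaveLevel_injective _ (h2.symm.trans h2')
  have := h3.symm.unique hcard h3'.symm
  exact Prod.ext this (by rw [h1, h1', this])

theorem strandGraph_adj_iff (hE : ∀ e ∈ E, ∃ i j : V, i ∈ A ∧ j ∉ A ∧ e = {i, j})
    (hEF : ∀ e ∈ EF, ∃ i j : V, i ≠ j ∧ ((i ∈ A ∧ j ∈ A) ∨ (i ∉ A ∧ j ∉ A)) ∧ e = {i, j})
    {n : ℕ} {x : Fin n → Finset V} {p q : V × Fin (n + 1)} :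
    (strandGraph E EF n x).Adj p q ↔ strandNext A E EF x p q ∨ strandNext A E EF x q p := by
  obtain ⟨k, a⟩ := p
  obtain ⟨l, b⟩ := q
  have hE' : ∀ e ∈ E, k ∈ e → l ∈ e → k ≠ l → (k ∈ A ↔ l ∉ A) := by
    intro e he
    obtain ⟨i, j, hi, hj, rfl⟩ := hE e he
    simp only [Finset.mem_insert, Finset.mem_singleton]
    grind
  have hEF' : ∀ e ∈ EF, k ∈ e → l ∈ e → (k ∈ A ↔ l ∈ A) := by
    intro e he
    obtain ⟨i, j, -, hij, rfl⟩ := hEF e he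
    simp only [Finset.mem_insert, Finset.mem_singleton]
    grind
  have hlev : ∀ t : Fin n, t.castSucc ≠ t.succ := fun t => Fin.castSucc_lt_succ.ne
  rw [strandGraph, SimpleGraph.fromRel_adj]
  simp only [strandRel, strandNext, enterLevel, leaveLevel, opConnects, ne_eq, Prod.mk.injEq]
  constructor
  · rintro ⟨-, ⟨t, h⟩ | ⟨t, h⟩⟩
    · rw [← exists_or]
      refine ⟨t, ?_⟩
      clear hE hEF
      grind (splits := 20)
    · rw [← exists_or]
      refine ⟨t, ?_⟩
      clear hE hEF
      grind (splits := 20)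
  · rintro (⟨t, h⟩ | ⟨t, h⟩)
    · refine ⟨by grind, ?_⟩
      rw [← exists_or]
      refine ⟨t, ?_⟩
      clear hE hEF
      grind (splits := 20)
    · refine ⟨by grind, ?_⟩
      rw [← exists_or]
      refine ⟨t, ?_⟩
      clear hE hEF
      grind (splits := 20)

end Strand

section Insert

variable {n : ℕ} (m : Fin (n + 1))

theorem val_predAbove (a : Fin (n + 2)) :
    (m.predAbove a : ℕ) = if (m : ℕ) < a then (a : ℕ) - 1 else a := by
  simp only [Fin.predAbove, Fin.lt_def, Fin.val_castSucc]
  split_ifs <;> rfl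

theorem predAbove_castSucc_succAbove (t : Fin n) :
    m.predAbove (m.succAbove t).castSucc = t.castSucc := by
  ext
  rw [val_predAbove]
  simp only [Fin.succAbove, Fin.lt_def, Fin.val_castSucc]
  split_ifs <;> simp only [Fin.val_castSucc, Fin.val_succ] at * <;> omega

theorem predAbove_succ_succAbove (t : Fin n) :
    m.predAbove (m.succAbove t).succ = t.succ := by
  ext
  rw [val_predAbove]
  simp only [Fin.succAbove, Fin.lt_def, Fin.val_castSucc]
  split_ifs <;> simp only [Fin.val_castSucc, Fin.val_succ] at * <;> omega

theorem predAbove_eq_iff (a b : Fin (n + 2)) : m.predAbove a = m.predAbove b ↔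
    a = b ∨ (a = m.castSucc ∧ b = m.succ) ∨ (a = m.succ ∧ b = m.castSucc) := by
  simp only [Fin.ext_iff, val_predAbove, Fin.val_castSucc, Fin.val_succ]
  split_ifs <;> omega

variable [DecidableEq V] {A : Finset V} {E EF : Finset (Finset V)} {x : Fin n → Finset V} {i : V}

theorem predAbove_enterLevel (t : Fin n) (k : V) :
    m.predAbove (enterLevel A (m.succAbove t) k) = enterLevel A t k := by
  unfold enterLevel
  split_ifs
  · exact predAbove_castSucc_succAbove m t
  · exact predAbove_succ_succAbove m t

theorem predAbove_leaveLevel (t : Fin n) (k : V) :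
    m.predAbove (leaveLevel A (m.succAbove t) k) = leaveLevel A t k := by
  unfold leaveLevel
  split_ifs
  · exact predAbove_succ_succAbove m t
  · exact predAbove_castSucc_succAbove m t

theorem strandNext.map_predAbove (hcard : ∀ e, e ∈ E ∨ e ∈ EF → e.card = 2)
    {a b : V × Fin (n + 2)}
    (h : strandNext A E EF (m.insertNth (α := fun _ => Finset V) {i} x) a b) :
    Prod.map id m.predAbove a = Prod.map id m.predAbove b ∨
      strandNext A E EF x (Prod.map id m.predAbove a) (Prod.map id m.predAbove b) := by
  obtain ⟨k, a⟩ := a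
  obtain ⟨l, b⟩ := b
  obtain ⟨t', h1, h2, h3⟩ := h
  dsimp only at h1 h2 h3
  rcases Fin.eq_self_or_eq_succAbove m t' with rfl | ⟨t, rfl⟩
  · left
    rw [Fin.insertNth_apply_same] at h3
    rcases h3 with ⟨rfl, -⟩ | ⟨h, -⟩
    · refine Prod.ext rfl ((predAbove_eq_iff _ _ _).2 ?_)
      subst h1 h2
      dsimp only [enterLevel, leaveLevel]
      split_ifs <;> simp
    · simpa using hcard _ h
  · right
    rw [Fin.insertNth_apply_succAbove] at h3
    subst h1 h2
    exact ⟨t, predAbove_enterLevel m t k, predAbove_leaveLevel m t l, h3⟩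

theorem strandNext.exists_lift {p q : V × Fin (n + 1)} (h : strandNext A E EF x p q) :
    ∃ a b, Prod.map id m.predAbove a = p ∧ Prod.map id m.predAbove b = q ∧
      strandNext A E EF (m.insertNth (α := fun _ => Finset V) {i} x) a b := by
  obtain ⟨k, p⟩ := p
  obtain ⟨l, q⟩ := q
  obtain ⟨t, h1, h2, h3⟩ := h
  dsimp only at h1 h2 h3
  refine ⟨(k, enterLevel A (m.succAbove t) k), (l, leaveLevel A (m.succAbove t) l),
    Prod.ext rfl ?_, Prod.ext rfl ?_, m.succAbove t, rfl, rfl, ?_⟩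
  · exact (predAbove_enterLevel m t k).trans h1.symm
  · exact (predAbove_leaveLevel m t l).trans h2.symm
  · rwa [Fin.insertNth_apply_succAbove]

theorem card_eq_two_of_mem (hE : ∀ e ∈ E, ∃ i j : V, i ∈ A ∧ j ∉ A ∧ e = {i, j})
    (hEF : ∀ e ∈ EF, ∃ i j : V, i ≠ j ∧ ((i ∈ A ∧ j ∈ A) ∨ (i ∉ A ∧ j ∉ A)) ∧ e = {i, j})
    (e : Finset V) (he : e ∈ E ∨ e ∈ EF) : e.card = 2 := by
  rcases he with he | he
  · obtain ⟨i, j, hi, hj, rfl⟩ := hE e he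
    exact Finset.card_pair (by rintro rfl; exact hj hi)
  · obtain ⟨i, j, hij, -, rfl⟩ := hEF e he
    exact Finset.card_pair hij

theorem isGluing_insertNth (hE : ∀ e ∈ E, ∃ i j : V, i ∈ A ∧ j ∉ A ∧ e = {i, j})
    (hEF : ∀ e ∈ EF, ∃ i j : V, i ≠ j ∧ ((i ∈ A ∧ j ∈ A) ∨ (i ∉ A ∧ j ∉ A)) ∧ e = {i, j}) :
    (strandGraph E EF (n + 1) (m.insertNth (α := fun _ => Finset V) {i} x)).IsGluing
      (strandGraph E EF n x) (Prod.map id m.predAbove) (i, m.castSucc) (i, m.succ) where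
  surj := Function.surjective_id.prodMap (Fin.predAbove_surjective m)
  map_eq := Prod.ext rfl ((predAbove_eq_iff _ _ _).2 (by simp))
  map_adj a b hab := by
    have hcard := card_eq_two_of_mem hE hEF
    rw [strandGraph_adj_iff hE hEF] at hab ⊢
    rcases hab with h | h
    · exact (h.map_predAbove m hcard).imp id .inl
    · exact (h.map_predAbove m hcard).imp Eq.symm .inr
  lift_adj p q hpq := by
    simp only [strandGraph_adj_iff hE hEF] at hpq ⊢
    rcases hpq with h | h
    · obtain ⟨a, b, ha, hb, hab⟩ := h.exists_lift m
      exact ⟨a, b, ha, hb, .inl hab⟩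
    · obtain ⟨a, b, ha, hb, hab⟩ := h.exists_lift m
      exact ⟨b, a, hb, ha, .inr hab⟩
  fiber := by
    rintro ⟨k, a⟩ ⟨l, b⟩ hab
    obtain ⟨rfl, hlev⟩ : k = l ∧ m.predAbove a = m.predAbove b :=
      ⟨(Prod.ext_iff.1 hab).1, (Prod.ext_iff.1 hab).2⟩
    by_cases hk : k = i
    · subst hk
      rcases (predAbove_eq_iff _ _ _).1 hlev with rfl | ⟨rfl, rfl⟩ | ⟨rfl, rfl⟩ <;> simp
    · have hadj : (strandGraph E EF (n + 1) (m.insertNth (α := fun _ => Finset V) {i} x)).Adj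
          (k, m.castSucc) (k, m.succ) := by
        rw [strandGraph, SimpleGraph.fromRel_adj]
        refine ⟨fun e => Fin.castSucc_lt_succ.ne (Prod.ext_iff.1 e).2,
          .inl ⟨m, .inl ⟨rfl, ?_, rfl, rfl⟩⟩⟩
        rwa [Fin.insertNth_apply_same, Finset.mem_singleton]
      rcases (predAbove_eq_iff _ _ _).1 hlev with rfl | ⟨rfl, rfl⟩ | ⟨rfl, rfl⟩
      · exact .inl rfl
      · exact .inr (.inl hadj)
      · exact .inr (.inl hadj.symm)

/-- Endpoint vertices of the strand graph of a configuration indexed by `Fin n`. -/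
def IsStrandEnd (x : Fin n → Finset V) (v : V × Fin (n + 1)) : Prop :=
  (v.2 : ℕ) = 0 ∨ (v.2 : ℕ) = n ∨
    ∃ t : Fin n, x t = {v.1} ∧ ((v.2 : ℕ) = (t : ℕ) ∨ (v.2 : ℕ) = (t : ℕ) + 1)

theorem IsStrandEnd.exists_lift (hcard : ∀ e, e ∈ E ∨ e ∈ EF → e.card = 2) (hi : i ∈ A)
    {u : V × Fin (n + 1)} (hu : IsStrandEnd x u) :
    ∃ a, Prod.map id m.predAbove a = u ∧
      ((a ≠ (i, m.succ) ∧
          ∀ b, ¬ strandNext A E EF (m.insertNth (α := fun _ => Finset V) {i} x) b a) ∨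
        (a ≠ (i, m.castSucc) ∧
          ∀ b, ¬ strandNext A E EF (m.insertNth (α := fun _ => Finset V) {i} x) a b)) := by
  obtain ⟨k, τ⟩ := u
  have henter : ∀ t, x t = {k} → ∀ b, ¬ strandNext A E EF
      (m.insertNth (α := fun _ => Finset V) {i} x) (k, enterLevel A (m.succAbove t) k) b := by
    rintro t ht b ⟨t', h1, -, h3⟩
    obtain rfl := enterLevel_injective _ h1
    rw [Fin.insertNth_apply_succAbove, ht] at h3
    exact not_opConnects_singleton hcard _ _ h3
  have hleave : ∀ t, x t = {k} → ∀ b, ¬ strandNext A E EF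
      (m.insertNth (α := fun _ => Finset V) {i} x) b (k, leaveLevel A (m.succAbove t) k) := by
    rintro t ht b ⟨t', -, h2, h3⟩
    obtain rfl := leaveLevel_injective _ h2
    rw [Fin.insertNth_apply_succAbove, ht] at h3
    exact not_opConnects_singleton hcard _ _ h3.symm
  have hne : ∀ t, enterLevel A (m.succAbove t) i ≠ m.castSucc := by
    intro t h
    rw [enterLevel, if_pos hi] at h
    exact Fin.succAbove_ne m t (Fin.castSucc_injective _ h)
  have hne' : ∀ t, leaveLevel A (m.succAbove t) i ≠ m.succ := by
    intro t h
    rw [leaveLevel, if_pos hi] at h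
    exact Fin.succAbove_ne m t (Fin.succ_injective _ h)
  rcases hu with h | h | ⟨t, ht, h⟩
  · dsimp only at h
    obtain rfl : τ = 0 := Fin.ext h
    refine ⟨(k, 0), by simp, ?_⟩
    by_cases hk : k ∈ A
    · refine .inl ⟨by simp [(Fin.succ_ne_zero _).symm], ?_⟩
      rintro b ⟨t, -, h2, -⟩
      rw [leaveLevel, if_pos hk] at h2
      exact Fin.succ_ne_zero _ h2.symm
    · refine .inr ⟨fun e => hk (by rw [(Prod.mk.inj e).1]; exact hi), ?_⟩
      rintro b ⟨t, h1, -, -⟩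
      rw [enterLevel, if_neg hk] at h1
      exact Fin.succ_ne_zero _ h1.symm
  · dsimp only at h
    obtain rfl : τ = Fin.last n := Fin.ext h
    refine ⟨(k, Fin.last _), by simp, ?_⟩
    by_cases hk : k ∈ A
    · refine .inr ⟨fun e => (Fin.castSucc_lt_last m).ne' (Prod.ext_iff.1 e).2, ?_⟩
      rintro b ⟨t, h1, -, -⟩
      rw [enterLevel, if_pos hk] at h1
      exact (Fin.castSucc_lt_last t).ne' h1
    · refine .inl ⟨fun e => hk (by rw [(Prod.mk.inj e).1]; exact hi), ?_⟩
      rintro b ⟨t, -, h2, -⟩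
      rw [leaveLevel, if_neg hk] at h2
      exact (Fin.castSucc_lt_last t).ne' h2
  · have hτ : τ = enterLevel A t k ∨ τ = leaveLevel A t k := by
      unfold enterLevel leaveLevel
      dsimp only at h
      simp only [Fin.ext_iff]
      split_ifs <;> simp <;> omega
    rcases hτ with rfl | rfl
    · refine ⟨(k, enterLevel A (m.succAbove t) k),
        Prod.ext rfl (predAbove_enterLevel m t k), .inr ⟨?_, henter t ht⟩⟩
      intro e
      obtain ⟨rfl, e⟩ := Prod.ext_iff.1 e
      exact hne t e
    · refine ⟨(k, leaveLevel A (m.succAbove t) k),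
        Prod.ext rfl (predAbove_leaveLevel m t k), .inl ⟨?_, hleave t ht⟩⟩
      intro e
      obtain ⟨rfl, e⟩ := Prod.ext_iff.1 e
      exact hne' t e

theorem isStrandEnd_of_forall_not_strandNext
    (hcard : ∀ e, e ∈ E ∨ e ∈ EF → e.card = 2)
    (hx : ∀ t, x t ∈ E ∪ EF ∨ ∃ k : V, x t = {k}) (hi : i ∈ A)
    {a : V × Fin (n + 2)} (ha : a ≠ (i, m.castSucc))
    (hout : ∀ b, ¬ strandNext A E EF (m.insertNth (α := fun _ => Finset V) {i} x) a b) :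
    IsStrandEnd x (Prod.map id m.predAbove a) := by
  obtain ⟨k, τ⟩ := a
  by_cases hτ : ∃ t' : Fin (n + 1), τ = enterLevel A t' k
  · obtain ⟨t', rfl⟩ := hτ
    have hs : m.insertNth (α := fun _ => Finset V) {i} x t' = {k} := by
      by_contra hne
      have hv : m.insertNth (α := fun _ => Finset V) {i} x t' ∈ E ∪ EF ∨
          ∃ k : V, m.insertNth (α := fun _ => Finset V) {i} x t' = {k} := by
        rcases Fin.eq_self_or_eq_succAbove m t' with rfl | ⟨t, rfl⟩
        · exact .inr ⟨i, by rw [Fin.insertNth_apply_same]⟩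
        · rw [Fin.insertNth_apply_succAbove]
          exact hx t
      obtain ⟨l, hl⟩ := exists_opConnects hcard hv hne
      exact hout (l, leaveLevel A t' l) ⟨t', rfl, rfl, hl⟩
    rcases Fin.eq_self_or_eq_succAbove m t' with rfl | ⟨t, rfl⟩
    · rw [Fin.insertNth_apply_same, Finset.singleton_inj] at hs
      subst hs
      rw [enterLevel, if_pos hi] at ha
      exact absurd rfl ha
    · rw [Fin.insertNth_apply_succAbove] at hs
      refine .inr (.inr ⟨t, hs, ?_⟩)
      rw [Prod.map_snd, predAbove_enterLevel]
      unfold enterLevel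
      split_ifs <;> simp
  · unfold enterLevel at hτ
    by_cases hk : k ∈ A
    · simp only [if_pos hk] at hτ
      rcases Fin.eq_castSucc_or_eq_last τ with ⟨t, rfl⟩ | rfl
      · exact absurd ⟨t, rfl⟩ hτ
      · exact .inr (.inl (by simp))
    · simp only [if_neg hk] at hτ
      rcases Fin.eq_zero_or_eq_succ τ with rfl | ⟨t, rfl⟩
      · exact .inl (by simp)
      · exact absurd ⟨t, rfl⟩ hτ

/-- Cutting a strand at `(i, m)` leaves its two ends connected exactly when its component was a
closed loop. -/
theorem reachable_insertNth_iff [Finite V]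
    (hE : ∀ e ∈ E, ∃ i j : V, i ∈ A ∧ j ∉ A ∧ e = {i, j})
    (hEF : ∀ e ∈ EF, ∃ i j : V, i ≠ j ∧ ((i ∈ A ∧ j ∈ A) ∨ (i ∉ A ∧ j ∉ A)) ∧ e = {i, j})
    (hx : ∀ t, x t ∈ E ∪ EF ∨ ∃ k : V, x t = {k}) (hi : i ∈ A) :
    (strandGraph E EF (n + 1) (m.insertNth (α := fun _ => Finset V) {i} x)).Reachable
        (i, m.castSucc) (i, m.succ) ↔
      ∀ u, (strandGraph E EF n x).Reachable u (i, m) → ¬ IsStrandEnd x u := by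
  have hcard := card_eq_two_of_mem hE hEF
  have hglue := isGluing_insertNth (x := x) (i := i) m hE hEF
  have hsucc : Prod.map id m.predAbove (i, m.succ) = (i, m) := by simp
  have hadj : ∀ a b, strandNext A E EF (m.insertNth (α := fun _ => Finset V) {i} x) a b →
      (strandGraph E EF (n + 1) (m.insertNth (α := fun _ => Finset V) {i} x)).Adj a b :=
    fun a b h => (strandGraph_adj_iff hE hEF).2 (.inl h)
  have hinj : ∀ a b c, strandNext A E EF (m.insertNth (α := fun _ => Finset V) {i} x) a c →
      strandNext A E EF (m.insertNth (α := fun _ => Finset V) {i} x) b c → a = b :=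
    fun _ _ _ h h' => h.left_unique hcard h'
  have hd : ∀ a, ¬ strandNext A E EF (m.insertNth (α := fun _ => Finset V) {i} x) a
      (i, m.succ) := by
    rintro a ⟨t, -, h2, h3⟩
    rw [leaveLevel, if_pos hi] at h2
    obtain rfl := Fin.succ_injective _ h2
    rw [Fin.insertNth_apply_same] at h3
    exact not_opConnects_singleton hcard _ _ h3.symm
  have hs : ∀ a, ¬ strandNext A E EF (m.insertNth (α := fun _ => Finset V) {i} x)
      (i, m.castSucc) a := by
    rintro a ⟨t, h1, -, h3⟩
    rw [enterLevel, if_pos hi] at h1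
    obtain rfl := Fin.castSucc_injective _ h1
    rw [Fin.insertNth_apply_same] at h3
    exact not_opConnects_singleton hcard _ _ h3
  constructor
  · intro hsd u hu hend
    obtain ⟨a, rfl, ha⟩ := hend.exists_lift (A := A) m hcard hi
    have hda : (strandGraph E EF (n + 1)
        (m.insertNth (α := fun _ => Finset V) {i} x)).Reachable (i, m.succ) a := by
      rcases hglue.reachable_lift hu a (i, m.succ) rfl hsucc with e | ⟨e, -⟩ | ⟨e, -⟩
      · exact e.symm
      · exact (e.trans hsd).symm
      · exact e.symm
    have horb : ∀ {a}, (strandGraph E EF (n + 1)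
        (m.insertNth (α := fun _ => Finset V) {i} x)).Reachable (i, m.succ) a → _ :=
      SimpleGraph.Reachable.reflTransGen
        (fun a b h => (strandGraph_adj_iff hE hEF).1 h) hinj hd
    rcases ha with ⟨hne, hin⟩ | ⟨hne, hout⟩
    · rcases Relation.ReflTransGen.cases_tail (horb hda) with e | ⟨b, -, hb⟩
      · exact hne e
      · exact hin b hb
    · have hstuck : ∀ {c e : V × Fin (n + 2)}, Relation.ReflTransGen (strandNext A E EF
          (m.insertNth (α := fun _ => Finset V) {i} x)) c e →
          (∀ b, ¬ strandNext A E EF (m.insertNth (α := fun _ => Finset V) {i} x) c b) →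
          c = e := by
        intro c e hce hc
        rcases Relation.ReflTransGen.cases_head hce with h | ⟨b, hb, -⟩
        · exact h
        · exact absurd hb (hc b)
      rcases Relation.ReflTransGen.total_of_right_unique
        (fun _ _ _ h h' => h.right_unique hcard h') (horb hda) (horb hsd.symm) with h | h
      · exact hne (hstuck h hout)
      · exact hne (hstuck h hs).symm
  · intro hloop
    refine (SimpleGraph.Reachable.of_reflTransGen hadj
      (Relation.ReflTransGen.of_exists_succ hinj hd fun a ha hne => ?_)).symm
    by_contra hout
    refine hloop (Prod.map id m.predAbove a) ?_
      (isStrandEnd_of_forall_not_strandNext m hcard hx hi hne (not_exists.1 hout))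
    rw [← hsucc]
    exact (hglue.reachable_map (SimpleGraph.Reachable.of_reflTransGen hadj ha)).symm

end Insert

theorem numLoopsL_eq {E EF : Finset (Finset V)} {l : List (Finset V)} {n : ℕ}
    {x : Fin n → Finset V} (hl : l = List.ofFn x) : numLoopsL E EF l = numLoops E EF n x := by
  have : ∀ (k : ℕ) (y : Fin k → Finset V) (h : k = n), (∀ t, y t = x (t.cast h)) →
      numLoops E EF k y = numLoops E EF n x := by
    rintro k y rfl h
    exact congrArg _ (funext h)
  subst hl
  exact this _ _ (List.length_ofFn ..) fun t => by simp; rfl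

theorem insertIdx_eq_ofFn_insertNth {α : Type*} (z : List α) (a : α) (m : Fin (z.length + 1)) :
    z.insertIdx m a = List.ofFn (m.insertNth (α := fun _ => α) a z.get) := by
  have hlen : (z.insertIdx m a).length = z.length + 1 :=
    List.length_insertIdx_of_le_length (Nat.le_of_lt_succ m.2) a
  refine List.ext_getElem (by rw [hlen, List.length_ofFn]) fun k hk hk' => ?_
  have hk2 : k < z.length + 1 := hlen ▸ hk
  rw [List.getElem_ofFn, List.getElem_insertIdx]
  rcases Fin.eq_self_or_eq_succAbove m ⟨k, hk2⟩ with h | ⟨t, h⟩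
  · have hv : k = m := congrArg Fin.val h
    rw [h, Fin.insertNth_apply_same]
    simp [hv]
  · have hv : k = (m.succAbove t : ℕ) := congrArg Fin.val h
    rw [h, Fin.insertNth_apply_succAbove]
    simp only [Fin.succAbove, Fin.lt_def] at hv
    split_ifs at hv with h1 <;> simp only [Fin.val_castSucc, Fin.val_succ] at hv h1
    · simp [hv, h1]
    · simp [hv, show ¬ (t : ℕ) + 1 < m by omega, show (t : ℕ) + 1 ≠ m by omega]

/-- Inserting a vertex operator at site `i` in position
`j ∈ {1,…,b+1}` of a configuration `z` of length `b` leaves the number of loops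
unchanged if the component of `(i, j−1)` in `G_z` is a closed loop (contains no
endpoint vertex), and increases it by one otherwise. -/
theorem insert_vertex_operator [Fintype V] [DecidableEq V]
    (A : Finset V) (E EF : Finset (Finset V))
    (hE : ∀ e ∈ E, ∃ i j : V, i ∈ A ∧ j ∉ A ∧ e = {i, j})
    (hEF : ∀ e ∈ EF, ∃ i j : V, i ≠ j ∧ ((i ∈ A ∧ j ∈ A) ∨ (i ∉ A ∧ j ∉ A)) ∧ e = {i, j})
    (z : List (Finset V))
    (hz : ∀ e ∈ z, e ∈ E ∪ EF ∨ ∃ k : V, e = ({k} : Finset V))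
    (i : V) (j : ℕ) (hj1 : 1 ≤ j) (hj2 : j ≤ z.length + 1) :
    ((∀ u ∈ ((strandGraph E EF z.length z.get).connectedComponentMk
          (i, ⟨j - 1, by omega⟩)).supp, ¬ isEndpoint z u) →
        numLoopsL E EF (z.insertIdx (j - 1) ({i} : Finset V)) = numLoopsL E EF z) ∧
    ((∃ u ∈ ((strandGraph E EF z.length z.get).connectedComponentMk
          (i, ⟨j - 1, by omega⟩)).supp, isEndpoint z u) →
        numLoopsL E EF (z.insertIdx (j - 1) ({i} : Finset V)) = numLoopsL E EF z + 1) := by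
  wlog hi : i ∈ A generalizing A
  · refine this Aᶜ (fun e he => ?_) (fun e he => ?_) (by simpa using hi)
    · obtain ⟨k, l, hk, hl, rfl⟩ := hE e he
      exact ⟨l, k, by simpa using hl, by simpa using hk, Finset.pair_comm _ _⟩
    · obtain ⟨k, l, hkl, h, rfl⟩ := hEF e he
      exact ⟨k, l, hkl, by simpa using h.symm, rfl⟩
  have hm : j - 1 < z.length + 1 := by omega
  have hx : ∀ t, z.get t ∈ E ∪ EF ∨ ∃ k : V, z.get t = {k} := fun t => hz _ (z.get_mem t)
  have hglue := isGluing_insertNth (x := z.get) (i := i) ⟨j - 1, hm⟩ hE hEF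
  have hiff := reachable_insertNth_iff ⟨j - 1, hm⟩ hE hEF hx hi
  have hcount := numLoopsL_eq (E := E) (EF := EF)
    (insertIdx_eq_ofFn_insertNth z {i} ⟨j - 1, hm⟩)
  dsimp only at hcount
  simp only [SimpleGraph.ConnectedComponent.mem_supp_iff, SimpleGraph.ConnectedComponent.eq]
  rw [hcount]
  constructor
  · exact fun h => hglue.card_eq_of_reachable (hiff.2 h)
  · rintro ⟨u, hu, hend⟩
    exact hglue.card_eq_of_not_reachable fun h => hiff.1 h u hu hend
end

section
/- Let z ∈ (ℰ ∪ ℰ_F ∪ 𝒱)^{b} be a configuration, let p_1 < … < p_k be the positions of its vertex operators with sites i_1,…,i_k (so k = k(z) is the number of vertex operators), and let q(z) ∈ (ℰ ∪ ℰ_F)^{b−k} be the configuration obtained by deleting all vertex operators. Associate to the m-th vertex operator the vertex (i_m, p_m − m) of the strand graph G_{q(z)}, and let ℓ(z) be the number of connected components of G_{q(z)} that contain no boundary vertex (closed loops of q(z)) and contain at least one associated vertex. Then L(z) = L(q(z)) + k(z) − ℓ(z). -/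
open SimpleGraph

variable {V : Type*}

/-- Fixed points of one of two involutions in an orbit of the group they generate: there are
exactly two, provided that the other involution has no fixed point. -/
theorem exists_other_fixed_point {D : Type*} [Finite D] (σ τ : Equiv.Perm D)
    (hσ : ∀ d, σ (σ d) = d) (hσ' : ∀ d, σ d ≠ d) (hτ : ∀ d, τ (τ d) = d)
    (x : D) (hx : τ x = x) :
    ∃ O : Set D, x ∈ O ∧ (∀ d ∈ O, σ d ∈ O) ∧ (∀ d ∈ O, τ d ∈ O) ∧
      (∀ S : Set D, x ∈ S → (∀ d ∈ S, σ d ∈ S) → (∀ d ∈ S, τ d ∈ S) → O ⊆ S) ∧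
      ∃ y ∈ O, y ≠ x ∧ ∀ d, (d ∈ O ∧ τ d = d) ↔ (d = x ∨ d = y) := by
  set ρ : Equiv.Perm D := σ * τ with hρ
  have hσ2 : σ * σ = 1 := Equiv.ext hσ
  have hτ2 : τ * τ = 1 := Equiv.ext hτ
  have hσi : σ⁻¹ = σ := inv_eq_of_mul_eq_one_left hσ2
  have hτi : τ⁻¹ = τ := inv_eq_of_mul_eq_one_left hτ2
  have hconj : τ * ρ * τ⁻¹ = ρ⁻¹ := by
    rw [hρ, mul_inv_rev, hσi, hτi, mul_assoc, mul_assoc, hτ2, mul_one]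
  have hτρ : ∀ i : ℤ, τ ((ρ ^ i) x) = (ρ ^ (-i)) x := by
    intro i
    have h : τ * ρ ^ i * τ⁻¹ = ρ ^ (-i) := by
      rw [← conj_zpow, hconj, inv_zpow, zpow_neg]
    have h' := congrArg (fun g : Equiv.Perm D => g x) h
    simpa [hτi, hx] using h'
  have hσρ : ∀ i : ℤ, σ ((ρ ^ i) x) = (ρ ^ (1 - i)) x := by
    intro i
    rw [sub_eq_add_neg, zpow_add, zpow_one, Equiv.Perm.mul_apply, ← hτρ, hρ,
      Equiv.Perm.mul_apply, hτ]
  have hper : ∀ j : ℤ, (ρ ^ j) x = x ↔ (MulAction.period ρ x : ℤ) ∣ j := fun j => by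
    rw [← MulAction.zpow_smul_eq_iff_period_dvd, Equiv.Perm.smul_def]
  have heq : ∀ i j : ℤ, (ρ ^ i) x = (ρ ^ j) x ↔ (MulAction.period ρ x : ℤ) ∣ i - j := fun i j => by
    rw [← hper, sub_eq_neg_add, zpow_add, Equiv.Perm.mul_apply, zpow_neg, Equiv.Perm.inv_eq_iff_eq]
  have hpos : 0 < MulAction.period ρ x :=
    Nat.pos_of_ne_zero fun h0 => by
      have h1 := MulAction.period_dvd_orderOf ρ x
      rw [h0, zero_dvd_iff] at h1
      exact (orderOf_pos ρ).ne' h1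
  obtain ⟨m, hm⟩ : Even (MulAction.period ρ x) := by
    by_contra hodd
    obtain ⟨m, hm⟩ := Nat.not_even_iff_odd.mp hodd
    refine hσ' ((ρ ^ ((m : ℤ) + 1)) x) ?_
    rw [hσρ, heq, hm]
    exact ⟨-1, by push_cast; ring⟩
  refine ⟨Set.range fun i : ℤ => (ρ ^ i) x, ⟨0, by simp⟩, ?_, ?_, ?_, (ρ ^ (m : ℤ)) x, ⟨m, rfl⟩,
    ?_, ?_⟩
  · rintro _ ⟨i, rfl⟩
    exact ⟨1 - i, (hσρ i).symm⟩
  · rintro _ ⟨i, rfl⟩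
    exact ⟨-i, (hτρ i).symm⟩
  · rintro S hxS hS1 hS2 _ ⟨i, rfl⟩
    have hup : ∀ d ∈ S, ρ d ∈ S := fun d hd => hS1 _ (hS2 _ hd)
    have hdown : ∀ d ∈ S, ρ⁻¹ d ∈ S := fun d hd => by
      rw [hρ, mul_inv_rev, hσi, hτi]; exact hS2 _ (hS1 _ hd)
    induction i with
    | zero => simpa using hxS
    | succ i ih =>
      have := hup _ ih
      rwa [← Equiv.Perm.mul_apply, ← zpow_one_add, add_comm] at this
    | pred i ih =>
      have := hdown _ ih
      rwa [← Equiv.Perm.mul_apply, ← zpow_neg_one, ← zpow_add, add_comm, ← sub_eq_add_neg] at this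
  · rw [Ne, hper, hm]
    rintro ⟨c, hc⟩
    have hm0 : 0 < m := by omega
    push_cast at hc
    have : (m : ℤ) * (1 - 2 * c) = 0 := by linear_combination hc
    rcases mul_eq_zero.mp this with h | h <;> omega
  · intro d
    constructor
    · rintro ⟨⟨i, rfl⟩, hi⟩
      rw [hτρ, heq, hm] at hi
      obtain ⟨c, hc⟩ := hi
      have hm0 : (m : ℤ) ≠ 0 := by omega
      have hic : i = m * (-c) := by
        push_cast at hc; linarith
      rcases Int.even_or_odd' (-c) with ⟨e, he | he⟩
      · left
        rw [hper, hm]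
        exact ⟨e, by rw [hic, he]; push_cast; ring⟩
      · right
        rw [heq, hm]
        exact ⟨e, by rw [hic, he]; push_cast; ring⟩
    · rintro (rfl | rfl)
      · exact ⟨⟨0, by simp⟩, hx⟩
      · refine ⟨⟨m, rfl⟩, ?_⟩
        rw [hτρ, heq, hm]
        exact ⟨-1, by push_cast; ring⟩

/-- If a graph arises from an involution `τ` on half-edges, two at each vertex, then the components
containing a half-edge fixed by `τ` contain exactly two of them. -/
theorem two_mul_card_connectedComponent {X : Type*} [Fintype X] [DecidableEq X]
    (G : SimpleGraph X) (τ : X × Bool → X × Bool)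
    (hτ : Function.Involutive τ) (hreach : ∀ d, G.Reachable d.1 (τ d).1)
    (hadj : ∀ u v, G.Adj u v → ∃ s, (τ (u, s)).1 = v) :
    2 * Nat.card G.ConnectedComponent =
      (Finset.univ.filter fun d => τ d = d).card +
        2 * Set.ncard {c : G.ConnectedComponent | ∀ v ∈ c.supp, ∀ s, τ (v, s) ≠ (v, s)} := by
  classical
  have hσ : Function.Involutive fun d : X × Bool => (d.1, !d.2) := fun d => by simp
  have key : ∀ c : G.ConnectedComponent,
      (Finset.univ.filter fun d => τ d = d ∧ G.connectedComponentMk d.1 = c).card =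
        if ∀ v ∈ c.supp, ∀ s, τ (v, s) ≠ (v, s) then 0 else 2 := by
    intro c
    split_ifs with hc
    · rw [Finset.card_eq_zero, Finset.filter_eq_empty_iff]
      rintro ⟨v, s⟩ - ⟨h1, h2⟩
      exact hc v h2 s h1
    · push Not at hc
      obtain ⟨v, hv, s, hs⟩ := hc
      obtain ⟨O, hxO, hO1, hO2, hOmin, y, hyO, hyx, hy⟩ :=
        exists_other_fixed_point (hσ.toPerm) (hτ.toPerm) hσ (fun d h => by
          have := congrArg Prod.snd h; simp at this) hτ (v, s) hs
      have hmem : ∀ d : X × Bool, d ∈ O ↔ G.connectedComponentMk d.1 = c := by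
        intro d
        rw [← (SimpleGraph.ConnectedComponent.mem_supp_iff _ _).mp hv, SimpleGraph.ConnectedComponent.eq]
        constructor
        · intro hd
          exact (hOmin {d | G.Reachable d.1 v} (SimpleGraph.Reachable.refl _) (fun _ h => h)
            (fun e h => (hreach e).symm.trans h)) hd
        · intro hd
          have hwalk : ∀ w, G.Reachable v w → ∀ s', (w, s') ∈ O := by
            intro w hw
            rw [SimpleGraph.reachable_iff_reflTransGen] at hw
            have hboth : ∀ e : X × Bool, e ∈ O → ∀ s', (e.1, s') ∈ O := by
              rintro ⟨a, t⟩ he s'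
              by_cases hts : t = s'
              · exact hts ▸ he
              · have := hO1 _ he
                have h2 : (!t) = s' := by cases t <;> cases s' <;> simp_all
                simpa [h2] using this
            induction hw with
            | refl => exact hboth _ hxO
            | tail _ hab ih =>
              obtain ⟨t, rfl⟩ := hadj _ _ hab
              exact hboth _ (hO2 _ (ih t))
          exact hwalk _ hd.symm d.2
      rw [Finset.card_eq_two]
      refine ⟨(v, s), y, hyx.symm, ?_⟩
      ext d
      have := hy d
      simp only [Function.Involutive.coe_toPerm, hmem] at this
      simp only [Finset.mem_filter, Finset.mem_univ, true_and, Finset.mem_insert,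
        Finset.mem_singleton, ← this, and_comm]
  rw [Finset.card_eq_sum_card_fiberwise (f := fun d : X × Bool => G.connectedComponentMk d.1)
    (t := Finset.univ) (fun _ _ => Finset.mem_coe.2 (Finset.mem_univ _)), Nat.card_eq_fintype_card]
  simp only [Finset.filter_filter, key]
  rw [Set.ncard_eq_toFinset_card', Finset.sum_ite, Finset.sum_const_zero, zero_add,
    Finset.sum_const, smul_eq_mul, ← Finset.card_univ, Set.toFinset_ofPred,
    ← Finset.card_filter_add_card_filter_not
      (fun c : G.ConnectedComponent => ∀ v ∈ c.supp, ∀ s, τ (v, s) ≠ (v, s))]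
  ring

/-- Components avoiding a set are preserved by a map that contracts a graph, as long as points
in a common fibre are either connected or both connected to the set. -/
theorem ncard_components_avoiding {X Y : Type*} (G : SimpleGraph X) (H : SimpleGraph Y)
    (f : X → Y) (S : Set X) (hf : Function.Surjective f)
    (hmap : ∀ u v, G.Adj u v → H.Reachable (f u) (f v))
    (hlift : ∀ a b, H.Adj a b → ∃ u v, f u = a ∧ f v = b ∧ G.Adj u v)
    (hfib : ∀ u v, f u = f v → G.Reachable u v ∨ (∃ s ∈ S, G.Reachable u s)) :
    Set.ncard {c : G.ConnectedComponent | ∀ v ∈ c.supp, v ∉ S} =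
      Set.ncard {c : H.ConnectedComponent | ∀ v ∈ c.supp, v ∉ f '' S} := by
  have hmap' : ∀ u v, G.Reachable u v → H.Reachable (f u) (f v) := by
    intro u v h
    rw [SimpleGraph.reachable_iff_reflTransGen] at h
    induction h with
    | refl => exact SimpleGraph.Reachable.refl _
    | tail _ hab ih => exact ih.trans (hmap _ _ hab)
  have hback : ∀ u, (∀ s ∈ S, ¬ G.Reachable u s) → ∀ b, H.Reachable (f u) b →
      ∀ v, f v = b → G.Reachable u v := by
    intro u hu b hb
    have hstep : ∀ w, G.Reachable u w → ∀ v, f w = f v → G.Reachable u v := by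
      intro w hw v hv
      rcases hfib w v hv with h | ⟨s, hs, h⟩
      · exact hw.trans h
      · exact absurd (hw.trans h) (hu s hs)
    rw [SimpleGraph.reachable_iff_reflTransGen] at hb
    induction hb with
    | refl => exact fun v hv => hstep u (SimpleGraph.Reachable.refl _) v hv.symm
    | tail _ hab ih =>
      obtain ⟨p, q, hp, hq, hpq⟩ := hlift _ _ hab
      exact fun v hv => hstep q ((ih p hp).trans hpq.reachable) v (hq.trans hv.symm)
  refine Set.ncard_congr (fun c _ => c.lift (fun u => H.connectedComponentMk (f u))
    fun u v p _ => SimpleGraph.ConnectedComponent.sound (hmap' u v p.reachable)) ?_ ?_ ?_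
  · intro c
    induction c using SimpleGraph.ConnectedComponent.ind with | _ u =>
    rintro hc _ hv ⟨s, hs, rfl⟩
    have hv' := SimpleGraph.ConnectedComponent.exact hv
    refine hc s (SimpleGraph.ConnectedComponent.sound (hback u (fun s hs h => hc s
      (SimpleGraph.ConnectedComponent.sound h.symm) hs) _ hv'.symm s rfl).symm) hs
  · intro c d
    induction c using SimpleGraph.ConnectedComponent.ind with | _ u =>
    induction d using SimpleGraph.ConnectedComponent.ind with | _ v =>
    intro hc _ h
    exact SimpleGraph.ConnectedComponent.sound (hback u (fun s hs h => hc s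
      (SimpleGraph.ConnectedComponent.sound h.symm) hs) _
      (SimpleGraph.ConnectedComponent.exact h) v rfl)
  · intro c
    induction c using SimpleGraph.ConnectedComponent.ind with | _ b =>
    obtain ⟨u, rfl⟩ := hf b
    intro hc
    exact ⟨G.connectedComponentMk u, fun s hs hsS => hc (f s)
      (SimpleGraph.ConnectedComponent.sound (hmap' _ _ (SimpleGraph.ConnectedComponent.exact hs)))
      ⟨s, hsS, rfl⟩, rfl⟩

open Classical in
/-- The other site of a two-site operator, and the site itself if there is none. -/
noncomputable def otherSite (e : Finset V) (v : V) : V :=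
  if h : ∃ w, w ≠ v ∧ e = {v, w} then h.choose else v

theorem otherSite_of_notMem {e : Finset V} {v : V} (hv : v ∉ e) : otherSite e v = v := by
  classical
  refine dif_neg ?_
  rintro ⟨w, -, rfl⟩
  simp at hv

theorem otherSite_eq {e : Finset V} (he : e.card = 2) {v w : V} (hv : v ∈ e) (hw : w ∈ e)
    (hne : v ≠ w) : otherSite e v = w := by
  classical
  have hvw : e = {v, w} := by
    symm
    refine Finset.eq_of_subset_of_card_le ?_ ?_
    · simp [Finset.insert_subset_iff, hv, hw]
    · rw [he, Finset.card_pair hne]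
  have h : ∃ w, w ≠ v ∧ e = {v, w} := ⟨w, hne.symm, hvw⟩
  unfold otherSite
  rw [dif_pos h]
  have h2 := h.choose_spec.2
  rw [h2] at hw
  simp only [Finset.mem_insert, Finset.mem_singleton] at hw
  rcases hw with hw | hw
  · exact absurd hw.symm hne
  · exact hw.symm

theorem exists_ne_mem {e : Finset V} (he : e.card = 2) (v : V) :
    ∃ w ∈ e, v ≠ w := by
  obtain ⟨w, hw, h⟩ := Finset.exists_mem_ne (by omega : 1 < e.card) v
  exact ⟨w, hw, h.symm⟩

open Classical in
/-- The involution a local operator induces on the half-edges of its slot; the Boolean records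
whether the half-edge is at the top of the slot. -/
noncomputable def slotMap (E EF : Finset (Finset V)) (e : Finset V) (d : V × Bool) : V × Bool :=
  if d.1 ∈ e ∧ e ∉ E ∪ EF then d
  else if e ∈ E ∧ d.1 ∈ e then (otherSite e d.1, d.2)
  else (otherSite e d.1, !d.2)

/-- The half-edge of the strand graph given by a half-edge of the slot `s`. -/
def slotDart {n : ℕ} (s : Fin n) (d : V × Bool) : (V × Fin (n + 1)) × Bool :=
  ((d.1, if d.2 then s.succ else s.castSucc), !d.2)

/-- The involution a configuration induces on the half-edges of its strand graph. -/
noncomputable def strandInvol (E EF : Finset (Finset V)) (n : ℕ) (x : Fin n → Finset V) :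
    (V × Fin (n + 1)) × Bool → (V × Fin (n + 1)) × Bool
  | ((v, t), true) => Fin.lastCases (motive := fun _ => (V × Fin (n + 1)) × Bool)
      ((v, Fin.last n), true) (fun s => slotDart s (slotMap E EF (x s) (v, false))) t
  | ((v, t), false) => Fin.cases (motive := fun _ => (V × Fin (n + 1)) × Bool)
      ((v, 0), false) (fun s => slotDart s (slotMap E EF (x s) (v, true))) t

theorem slotMap_involutive [DecidableEq V] {E EF : Finset (Finset V)}
    (h2 : ∀ e ∈ E ∪ EF, e.card = 2) (e : Finset V) :
    Function.Involutive (slotMap E EF e) := by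
  classical
  rintro ⟨v, b⟩
  by_cases hv : v ∈ e
  · by_cases he : e ∈ E ∪ EF
    · obtain ⟨w, hw, hne⟩ := exists_ne_mem (h2 e he) v
      have h1 := otherSite_eq (h2 e he) hv hw hne
      have h1' := otherSite_eq (h2 e he) hw hv hne.symm
      by_cases hE : e ∈ E
      · simp [slotMap, hv, hw, hE, h1, h1']
      · have hF : e ∈ EF := (Finset.mem_union.mp he).resolve_left hE
        simp [slotMap, hE, hF, h1, h1']
    · have he' : e ∉ E ∧ e ∉ EF := by simpa using he
      simp [slotMap, hv, he']
  · simp [slotMap, hv, otherSite_of_notMem hv]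

theorem slotMap_eq_self_iff [DecidableEq V] {E EF : Finset (Finset V)}
    (h2 : ∀ e ∈ E ∪ EF, e.card = 2) (e : Finset V) (d : V × Bool) :
    slotMap E EF e d = d ↔ d.1 ∈ e ∧ e ∉ E ∪ EF := by
  classical
  obtain ⟨v, b⟩ := d
  by_cases hv : v ∈ e
  · by_cases he : e ∈ E ∪ EF
    · obtain ⟨w, hw, hne⟩ := exists_ne_mem (h2 e he) v
      have h1 := otherSite_eq (h2 e he) hv hw hne
      by_cases hE : e ∈ E
      · simp [slotMap, hv, hE, h1, hne.symm]
      · have hF : e ∈ EF := (Finset.mem_union.mp he).resolve_left hE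
        simp [slotMap, hE, hF, h1, hne.symm]
    · have he' : e ∉ E ∧ e ∉ EF := by simpa using he
      simp [slotMap, hv, he']
  · simp [slotMap, hv]

theorem slotDart_injective {n : ℕ} (s : Fin n) :
    Function.Injective (slotDart (V := V) s) := by
  rintro ⟨v, b⟩ ⟨w, c⟩ h
  cases b <;> cases c <;> simp_all [slotDart]

section

variable (E EF : Finset (Finset V)) (n : ℕ) (x : Fin n → Finset V)

theorem strandInvol_slotDart (s : Fin n) (d : V × Bool) :
    strandInvol E EF n x (slotDart s d) = slotDart s (slotMap E EF (x s) d) := by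
  obtain ⟨v, b⟩ := d
  cases b <;> simp [slotDart, strandInvol]

theorem strandInvol_last (v : V) :
    strandInvol E EF n x ((v, Fin.last n), true) = ((v, Fin.last n), true) := by
  simp [strandInvol]

theorem strandInvol_zero (v : V) :
    strandInvol E EF n x ((v, 0), false) = ((v, 0), false) := by
  simp [strandInvol]

end

theorem dart_cases {n : ℕ} (d : (V × Fin (n + 1)) × Bool) :
    (∃ v, d = ((v, Fin.last n), true)) ∨ (∃ v, d = ((v, 0), false)) ∨ ∃ s y, d = slotDart s y := by
  obtain ⟨⟨v, t⟩, b⟩ := d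
  cases b
  · refine Fin.cases (Or.inr (Or.inl ⟨v, rfl⟩)) (fun s => Or.inr (Or.inr ⟨s, (v, true), ?_⟩)) t
    simp [slotDart]
  · refine Fin.lastCases (Or.inl ⟨v, rfl⟩) (fun s => Or.inr (Or.inr ⟨s, (v, false), ?_⟩)) t
    simp [slotDart]

theorem reachable_of_strandRel {E EF : Finset (Finset V)} {n : ℕ} {x : Fin n → Finset V}
    {p q : V × Fin (n + 1)} (h : strandRel E EF n x p q) :
    (strandGraph E EF n x).Reachable p q := by
  by_cases hpq : p = q
  · exact hpq ▸ SimpleGraph.Reachable.refl _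
  · exact SimpleGraph.Adj.reachable ((SimpleGraph.fromRel_adj _ _ _).mpr ⟨hpq, Or.inl h⟩)

theorem strandInvol_reachable [DecidableEq V] {E EF : Finset (Finset V)}
    (h2 : ∀ e ∈ E ∪ EF, e.card = 2) {n : ℕ} (x : Fin n → Finset V)
    (d : (V × Fin (n + 1)) × Bool) :
    (strandGraph E EF n x).Reachable d.1 (strandInvol E EF n x d).1 := by
  classical
  rcases dart_cases d with ⟨v, rfl⟩ | ⟨v, rfl⟩ | ⟨s, ⟨v, b⟩, rfl⟩
  · rw [strandInvol_last]
  · rw [strandInvol_zero]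
  rw [strandInvol_slotDart]
  by_cases hv : v ∈ x s
  · by_cases he : x s ∈ E ∪ EF
    · obtain ⟨w, hw, hne⟩ := exists_ne_mem (h2 _ he) v
      have h1 := otherSite_eq (h2 _ he) hv hw hne
      by_cases hE : x s ∈ E
      · apply reachable_of_strandRel
        refine ⟨s, Or.inr (Or.inl ⟨hE, ?_⟩)⟩
        cases b <;> simp [slotDart, slotMap, hE, hv, h1, hw, hne]
      · have hF : x s ∈ EF := (Finset.mem_union.mp he).resolve_left hE
        cases b
        · apply reachable_of_strandRel
          refine ⟨s, Or.inr (Or.inr ⟨hF, ?_⟩)⟩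
          simp [slotDart, slotMap, hE, hF, hv, h1, hw, hne]
        · apply SimpleGraph.Reachable.symm
          apply reachable_of_strandRel
          refine ⟨s, Or.inr (Or.inr ⟨hF, ?_⟩)⟩
          simp [slotDart, slotMap, hE, hF, hv, h1, hw, hne.symm]
    · rw [(slotMap_eq_self_iff h2 (x s) (v, b)).mpr ⟨hv, he⟩]
  · cases b
    · apply reachable_of_strandRel
      refine ⟨s, Or.inl ?_⟩
      simp [slotDart, slotMap, hv, otherSite_of_notMem hv]
    · apply SimpleGraph.Reachable.symm
      apply reachable_of_strandRel
      refine ⟨s, Or.inl ?_⟩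
      simp [slotDart, slotMap, hv, otherSite_of_notMem hv]

theorem exists_strandInvol_of_adj [DecidableEq V] {E EF : Finset (Finset V)}
    (h2 : ∀ e ∈ E ∪ EF, e.card = 2) (hdisj : Disjoint E EF) {n : ℕ} (x : Fin n → Finset V)
    (u v : V × Fin (n + 1)) (h : (strandGraph E EF n x).Adj u v) :
    ∃ s, (strandInvol E EF n x (u, s)).1 = v := by
  classical
  have hslot : ∀ (s : Fin n) (d : V × Bool) (u v : V × Fin (n + 1)), (slotDart s d).1 = u →
      (slotDart s (slotMap E EF (x s) d)).1 = v → ∃ s, (strandInvol E EF n x (u, s)).1 = v := by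
    rintro s d _ _ rfl rfl
    exact ⟨!d.2, by rw [← strandInvol_slotDart]; rfl⟩
  obtain ⟨a, i⟩ := u
  obtain ⟨c, j⟩ := v
  rcases ((SimpleGraph.fromRel_adj _ _ _).mp h).2 with
    ⟨t, ⟨h1, h3, h4, h5⟩ | ⟨h1, h3, h4, h5, ⟨h6, h7⟩ | ⟨h6, h7⟩⟩ | ⟨h1, h3, h4, h5, h6, h7⟩⟩ |
    ⟨t, ⟨h1, h3, h4, h5⟩ | ⟨h1, h3, h4, h5, ⟨h6, h7⟩ | ⟨h6, h7⟩⟩ | ⟨h1, h3, h4, h5, h6, h7⟩⟩ <;>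
    dsimp only at *
  · subst h1 h4 h5
    apply hslot t (a, false) <;> simp [slotDart, slotMap, h3, otherSite_of_notMem h3]
  · subst h6 h7
    have := otherSite_eq (h2 _ (Finset.mem_union_left _ h1)) h3 h4 h5
    apply hslot t (a, false) <;> simp [slotDart, slotMap, h3, h1, this]
  · subst h6 h7
    have := otherSite_eq (h2 _ (Finset.mem_union_left _ h1)) h3 h4 h5
    apply hslot t (a, true) <;> simp [slotDart, slotMap, h3, h1, this]
  · subst h6 h7
    have hE : x t ∉ E := Finset.disjoint_right.mp hdisj h1
    have := otherSite_eq (h2 _ (Finset.mem_union_right _ h1)) h3 h4 h5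
    apply hslot t (a, false) <;> simp [slotDart, slotMap, hE, h1, this]
  · subst h1 h4 h5
    apply hslot t (c, true) <;> simp [slotDart, slotMap, h3, otherSite_of_notMem h3]
  · subst h6 h7
    have := otherSite_eq (h2 _ (Finset.mem_union_left _ h1)) h4 h3 h5.symm
    apply hslot t (a, false) <;> simp [slotDart, slotMap, h4, h1, this]
  · subst h6 h7
    have := otherSite_eq (h2 _ (Finset.mem_union_left _ h1)) h4 h3 h5.symm
    apply hslot t (a, true) <;> simp [slotDart, slotMap, h4, h1, this]
  · subst h6 h7
    have hE : x t ∉ E := Finset.disjoint_right.mp hdisj h1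
    have := otherSite_eq (h2 _ (Finset.mem_union_right _ h1)) h4 h3 h5.symm
    apply hslot t (a, true) <;> simp [slotDart, slotMap, hE, h1, this]

/-- The vertices of the strand graph where strands end: the boundary and the two vertices next to
each vertex operator. -/
def strandEnds [DecidableEq V] (E EF : Finset (Finset V)) (n : ℕ) (x : Fin n → Finset V) :
    Set (V × Fin (n + 1)) :=
  {v | v.2 = 0 ∨ v.2 = Fin.last n ∨
    ∃ t, x t ∉ E ∪ EF ∧ v.1 ∈ x t ∧ (v.2 = t.castSucc ∨ v.2 = t.succ)}

theorem exists_strandInvol_eq_self_iff [DecidableEq V] {E EF : Finset (Finset V)}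
    (h2 : ∀ e ∈ E ∪ EF, e.card = 2) {n : ℕ} (x : Fin n → Finset V) (v : V × Fin (n + 1)) :
    (∃ s, strandInvol E EF n x (v, s) = (v, s)) ↔ v ∈ strandEnds E EF n x := by
  have hfix : ∀ s d, strandInvol E EF n x (slotDart s d) = slotDart s d ↔
      d.1 ∈ x s ∧ x s ∉ E ∪ EF := fun s d => by
    rw [strandInvol_slotDart, (slotDart_injective s).eq_iff, slotMap_eq_self_iff h2]
  constructor
  · rintro ⟨b, hb⟩
    rcases dart_cases (v, b) with ⟨w, hw⟩ | ⟨w, hw⟩ | ⟨s, ⟨w, c⟩, hw⟩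
    · exact Or.inr (Or.inl (by simp_all))
    · exact Or.inl (by simp_all)
    · rw [hw, hfix] at hb
      refine Or.inr (Or.inr ⟨s, hb.2, ?_⟩)
      have hv : v = _ := congrArg Prod.fst hw
      subst hv
      refine ⟨hb.1, ?_⟩
      cases c <;> simp [slotDart]
  · obtain ⟨w, i⟩ := v
    rintro (h | h | ⟨t, h1, h3, h | h⟩) <;> dsimp only at h <;> subst h
    · exact ⟨false, strandInvol_zero ..⟩
    · exact ⟨true, strandInvol_last ..⟩
    · exact ⟨true, (hfix t (w, false)).mpr ⟨h3, h1⟩⟩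
    · exact ⟨false, (hfix t (w, true)).mpr ⟨h3, h1⟩⟩

theorem card_filter_strandInvol_eq_self [Fintype V] [DecidableEq V] {E EF : Finset (Finset V)}
    (h2 : ∀ e ∈ E ∪ EF, e.card = 2) {n : ℕ} (x : Fin n → Finset V)
    (hx : ∀ t, x t ∈ E ∪ EF ∨ ∃ k, x t = {k}) :
    (Finset.univ.filter fun d => strandInvol E EF n x d = d).card =
      2 * (Fintype.card V + (Finset.univ.filter fun t => x t ∉ E ∪ EF).card) := by
  have hfix : ∀ s d, strandInvol E EF n x (slotDart s d) = slotDart s d ↔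
      d.1 ∈ x s ∧ x s ∉ E ∪ EF := fun s d => by
    rw [strandInvol_slotDart, (slotDart_injective s).eq_iff, slotMap_eq_self_iff h2]
  have hfalse : ∀ s v, strandInvol E EF n x ((v, s.succ), false) = ((v, s.succ), false) ↔
      v ∈ x s ∧ x s ∉ E ∪ EF := fun s v => hfix s (v, true)
  have htrue : ∀ s v, strandInvol E EF n x ((v, s.castSucc), true) = ((v, s.castSucc), true) ↔
      v ∈ x s ∧ x s ∉ E ∪ EF := fun s v => hfix s (v, false)
  have hslot : ∀ s, (∑ v : V, if v ∈ x s ∧ x s ∉ E ∪ EF then 1 else 0) =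
      if x s ∉ E ∪ EF then 1 else 0 := by
    intro s
    by_cases hs : x s ∈ E ∪ EF
    · simp [hs]
    · obtain ⟨k, hk⟩ := (hx s).resolve_left hs
      simp only [hs, not_false_eq_true, and_true, if_true]
      simp [hk]
  rw [Finset.card_filter, Finset.card_filter, Fintype.sum_prod_type_right]
  simp only [Fintype.sum_bool, Fintype.sum_prod_type_right (α₁ := V)]
  rw [Fin.sum_univ_castSucc, Fin.sum_univ_succ (n := n)]
  simp only [htrue, hfalse, hslot, strandInvol_zero, strandInvol_last]
  simp
  ring

/-- The number of loops in terms of the number of closed loops. -/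
theorem numLoops_eq [Fintype V] [DecidableEq V] {E EF : Finset (Finset V)}
    (h2 : ∀ e ∈ E ∪ EF, e.card = 2) (hdisj : Disjoint E EF) {n : ℕ} (x : Fin n → Finset V)
    (hx : ∀ t, x t ∈ E ∪ EF ∨ ∃ k, x t = {k}) :
    numLoops E EF n x = Fintype.card V + (Finset.univ.filter fun t => x t ∉ E ∪ EF).card +
      Set.ncard {c : (strandGraph E EF n x).ConnectedComponent |
        ∀ v ∈ c.supp, v ∉ strandEnds E EF n x} := by
  have hinv : Function.Involutive (strandInvol E EF n x) := by
    intro d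
    rcases dart_cases d with ⟨v, rfl⟩ | ⟨v, rfl⟩ | ⟨s, y, rfl⟩
    · simp only [strandInvol_last]
    · simp only [strandInvol_zero]
    · simp only [strandInvol_slotDart, slotMap_involutive h2 (x s) y]
  have h := two_mul_card_connectedComponent (strandGraph E EF n x) (strandInvol E EF n x) hinv
    (strandInvol_reachable h2 x) (exists_strandInvol_of_adj h2 hdisj x)
  rw [card_filter_strandInvol_eq_self h2 x hx] at h
  simp only [← exists_strandInvol_eq_self_iff h2, not_exists]
  unfold numLoops
  simp only [ne_eq] at h
  omega

section FilterIndex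

variable {α : Type*} (p : α → Bool)

theorem length_filter_take_succ (l : List α) (t : ℕ) (ht : t < l.length) :
    ((l.take (t + 1)).filter p).length = ((l.take t).filter p).length + if p l[t] then 1 else 0 := by
  rw [List.take_succ_eq_append_getElem ht, List.filter_append, List.length_append]
  by_cases h : p l[t] <;> simp [h]

theorem length_filter_take_le (l : List α) (t : ℕ) :
    ((l.take t).filter p).length ≤ (l.filter p).length :=
  ((List.take_sublist t l).filter p).length_le

theorem exists_getElem_filter (l : List α) (t : ℕ) (ht : t < l.length) (hp : p l[t]) :
    ∃ h : ((l.take t).filter p).length < (l.filter p).length,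
      (l.filter p)[((l.take t).filter p).length] = l[t] := by
  induction l generalizing t with
  | nil => simp at ht
  | cons a l ih =>
    cases t with
    | zero =>
      have ha : p a = true := by simpa using hp
      simp [ha]
    | succ t =>
      obtain ⟨h1, h2⟩ := ih t (by simpa using ht) (by simpa using hp)
      by_cases ha : p a
      · simp only [List.take_succ_cons, List.filter_cons, ha, if_true, List.length_cons]
        exact ⟨by omega, by simpa using h2⟩
      · simp only [List.take_succ_cons, List.filter_cons, ha]
        exact ⟨h1, by simpa using h2⟩

theorem exists_getElem_of_filter (l : List α) (s : ℕ) (hs : s < (l.filter p).length) :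
    ∃ (t : ℕ) (ht : t < l.length), ((l.take t).filter p).length = s ∧
      p l[t] ∧ (l.filter p)[s] = l[t] := by
  induction l generalizing s with
  | nil => simp at hs
  | cons a l ih =>
    by_cases ha : p a
    · cases s with
      | zero => exact ⟨0, by simp, by simp, by simpa using ha, by simp [ha]⟩
      | succ s =>
        obtain ⟨t, ht, h1, h2, h3⟩ := ih s (by simpa [ha] using hs)
        exact ⟨t + 1, by simpa using ht, by simp [ha, h1], by simpa using h2, by simpa [ha] using h3⟩
    · obtain ⟨t, ht, h1, h2, h3⟩ := ih s (by simpa [ha] using hs)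
      exact ⟨t + 1, by simpa using ht, by simp [ha, h1], by simpa using h2, by simpa [ha] using h3⟩

theorem card_filter_get (l : List α) :
    (Finset.univ.filter fun t => p (l.get t)).card = (l.filter p).length := by
  induction l with
  | nil => simp
  | cons a l ih =>
    have h := Fin.card_filter_univ_succ fun t : Fin (l.length + 1) => p ((a :: l).get t) = true
    refine h.trans ?_
    by_cases ha : p a <;> simp_all

/-- The map on strand graph vertices which forgets the slots whose operator does not satisfy `p`. -/
def contractTime {W : Type*} (l : List α) (v : W × Fin (l.length + 1)) :
    W × Fin ((l.filter p).length + 1) :=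
  (v.1, ⟨((l.take v.2).filter p).length, Nat.lt_succ_of_le (length_filter_take_le p l v.2)⟩)

theorem contractTime_surjective {W : Type*} (l : List α) :
    Function.Surjective (contractTime p (W := W) l) := by
  rintro ⟨w, s, hs⟩
  rcases Nat.lt_succ_iff_lt_or_eq.mp hs with h | rfl
  · obtain ⟨t, ht, h1, -, -⟩ := exists_getElem_of_filter p l s h
    exact ⟨(w, ⟨t, by omega⟩), by simp [contractTime, h1]⟩
  · exact ⟨(w, Fin.last _), by simp [contractTime]⟩

end FilterIndex

section Contract

variable [DecidableEq V] {E EF : Finset (Finset V)} (z : List (Finset V))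

local notation "pz" => (fun e : Finset V => decide (e ∈ E ∪ EF))

theorem contractTime_succ_of_notMem (t : Fin z.length) (ht : z.get t ∉ E ∪ EF) (v : V) :
    contractTime pz z (v, t.succ) = contractTime pz z (v, t.castSucc) := by
  have := length_filter_take_succ pz z t t.2
  rw [List.get_eq_getElem] at ht
  simp only [ht, decide_false, Bool.false_eq_true, if_false, add_zero] at this
  simpa [contractTime] using this

theorem exists_slot_of_mem (t : Fin z.length) (ht : z.get t ∈ E ∪ EF) :
    ∃ s : Fin (z.filter pz).length, (z.filter pz).get s = z.get t ∧
      (∀ v : V, contractTime pz z (v, t.castSucc) = (v, s.castSucc)) ∧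
      (∀ v : V, contractTime pz z (v, t.succ) = (v, s.succ)) := by
  rw [List.get_eq_getElem] at ht
  obtain ⟨h1, h2⟩ := exists_getElem_filter pz z t t.2 (by simpa using ht)
  refine ⟨⟨_, h1⟩, h2, fun v => rfl, fun v => ?_⟩
  have := length_filter_take_succ pz z t t.2
  simp only [ht, decide_true, if_true] at this
  simpa [contractTime] using this

theorem exists_slot_lift (s : Fin (z.filter pz).length) :
    ∃ t : Fin z.length, z.get t = (z.filter pz).get s ∧
      (∀ v : V, contractTime pz z (v, t.castSucc) = (v, s.castSucc)) ∧
      (∀ v : V, contractTime pz z (v, t.succ) = (v, s.succ)) := by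
  obtain ⟨t, ht, h1, h2, h3⟩ := exists_getElem_of_filter pz z s s.2
  refine ⟨⟨t, ht⟩, h3.symm, fun v => ?_, fun v => ?_⟩
  · exact Prod.ext rfl (Fin.ext h1)
  · have := length_filter_take_succ pz z t ht
    rw [if_pos h2, h1] at this
    exact Prod.ext rfl (Fin.ext this)

theorem strandRel_contractTime {u v : V × Fin (z.length + 1)}
    (h : strandRel E EF z.length z.get u v) :
    (strandGraph E EF (z.filter pz).length (z.filter pz).get).Reachable
      (contractTime pz z u) (contractTime pz z v) := by
  obtain ⟨a, i⟩ := u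
  obtain ⟨c, j⟩ := v
  obtain ⟨t, h⟩ := h
  by_cases ht : z.get t ∈ E ∪ EF
  · obtain ⟨s, h1, h2, h3⟩ := exists_slot_of_mem z t ht
    apply reachable_of_strandRel
    refine ⟨s, ?_⟩
    rw [h1]
    rcases h with ⟨h4, h5, h6, h7⟩ | ⟨h4, h5, h6, h7, ⟨h8, h9⟩ | ⟨h8, h9⟩⟩ |
      ⟨h4, h5, h6, h7, h8, h9⟩ <;> dsimp only at * <;> subst_vars
    · rw [h2, h3]
      exact Or.inl ⟨rfl, h5, rfl, rfl⟩
    · rw [h2, h2]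
      exact Or.inr (Or.inl ⟨h4, h5, h6, h7, Or.inl ⟨rfl, rfl⟩⟩)
    · rw [h3, h3]
      exact Or.inr (Or.inl ⟨h4, h5, h6, h7, Or.inr ⟨rfl, rfl⟩⟩)
    · rw [h2, h3]
      exact Or.inr (Or.inr ⟨h4, h5, h6, h7, rfl, rfl⟩)
  · rcases h with ⟨h4, h5, h6, h7⟩ | ⟨h4, -⟩ | ⟨h4, -⟩
    · dsimp only at *
      subst h4 h6 h7
      rw [contractTime_succ_of_notMem z t ht]
    · exact absurd (Finset.mem_union_left _ h4) ht
    · exact absurd (Finset.mem_union_right _ h4) ht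

theorem exists_strandRel_lift {a c : V × Fin ((z.filter pz).length + 1)}
    (h : strandRel E EF (z.filter pz).length (z.filter pz).get a c) :
    ∃ u v, contractTime pz z u = a ∧ contractTime pz z v = c ∧
      strandRel E EF z.length z.get u v := by
  obtain ⟨a, i⟩ := a
  obtain ⟨c, j⟩ := c
  obtain ⟨s, h⟩ := h
  obtain ⟨t, h1, h2, h3⟩ := exists_slot_lift z s
  rw [← h1] at h
  rcases h with ⟨h4, h5, h6, h7⟩ | ⟨h4, h5, h6, h7, ⟨h8, h9⟩ | ⟨h8, h9⟩⟩ |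
    ⟨h4, h5, h6, h7, h8, h9⟩ <;> dsimp only at * <;> subst_vars
  · exact ⟨_, _, h2 _, h3 _, t, Or.inl ⟨rfl, h5, rfl, rfl⟩⟩
  · exact ⟨_, _, h2 a, h2 c, t, Or.inr (Or.inl ⟨h4, h5, h6, h7, Or.inl ⟨rfl, rfl⟩⟩)⟩
  · exact ⟨_, _, h3 a, h3 c, t, Or.inr (Or.inl ⟨h4, h5, h6, h7, Or.inr ⟨rfl, rfl⟩⟩)⟩
  · exact ⟨_, _, h2 a, h3 c, t, Or.inr (Or.inr ⟨h4, h5, h6, h7, rfl, rfl⟩)⟩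

/-- Vertices identified by `contractTime` are joined by a strand or both lie on strands which
end. -/
theorem reachable_or_ends_of_contractTime_eq (v : V) (i d : ℕ) (hd : i + d < z.length + 1)
    (h : contractTime pz z (v, (⟨i, by omega⟩ : Fin (z.length + 1))) =
      contractTime pz z (v, (⟨i + d, hd⟩ : Fin (z.length + 1)))) :
    (strandGraph E EF z.length z.get).Reachable (v, ⟨i, by omega⟩) (v, ⟨i + d, hd⟩) ∨
    ((∃ s ∈ strandEnds E EF z.length z.get,
      (strandGraph E EF z.length z.get).Reachable (v, ⟨i, by omega⟩) s) ∧
    (∃ s ∈ strandEnds E EF z.length z.get,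
      (strandGraph E EF z.length z.get).Reachable (v, ⟨i + d, hd⟩) s)) := by
  induction d with
  | zero => exact Or.inl (SimpleGraph.Reachable.refl _)
  | succ d ih =>
    have htl : i + d < z.length := by omega
    let t : Fin z.length := ⟨i + d, htl⟩
    have hstep := length_filter_take_succ pz z (i + d) htl
    have hmono : ((z.take i).filter pz).length ≤ ((z.take (i + d)).filter pz).length :=
      ((List.take_sublist_take_left (Nat.le_add_right i d)).filter pz).length_le
    have heq : ((z.take i).filter pz).length = ((z.take (i + d + 1)).filter pz).length := by
      simpa [contractTime, ← add_assoc] using h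
    have ht : z.get t ∉ E ∪ EF := by
      intro ht
      rw [if_pos (by simpa using ht)] at hstep
      omega
    have h' : ((z.take i).filter pz).length = ((z.take (i + d)).filter pz).length := by
      split_ifs at hstep <;> omega
    have ih := ih (by omega) (by simp only [contractTime]; simpa using h')
    by_cases hv : v ∈ z.get t
    · have h1 : (v, t.castSucc) ∈ strandEnds E EF z.length z.get :=
        Or.inr (Or.inr ⟨t, ht, hv, Or.inl rfl⟩)
      have h2 : (v, t.succ) ∈ strandEnds E EF z.length z.get :=
        Or.inr (Or.inr ⟨t, ht, hv, Or.inr rfl⟩)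
      refine Or.inr ⟨?_, _, h2, SimpleGraph.Reachable.refl _⟩
      rcases ih with ih | ⟨ih, -⟩
      · exact ⟨_, h1, ih⟩
      · exact ih
    · have hr : (strandGraph E EF z.length z.get).Reachable (v, t.castSucc) (v, t.succ) :=
        reachable_of_strandRel ⟨t, Or.inl ⟨rfl, hv, rfl, rfl⟩⟩
      rcases ih with ih | ⟨ih, s, hs, ih'⟩
      · exact Or.inl (ih.trans hr)
      · exact Or.inr ⟨ih, s, hs, hr.symm.trans ih'⟩

theorem ncard_components_contractTime :
    Set.ncard {c : (strandGraph E EF z.length z.get).ConnectedComponent |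
        ∀ v ∈ c.supp, v ∉ strandEnds E EF z.length z.get} =
      Set.ncard {c : (strandGraph E EF (z.filter pz).length (z.filter pz).get).ConnectedComponent |
        ∀ v ∈ c.supp, v ∉ contractTime pz z '' strandEnds E EF z.length z.get} := by
  apply ncard_components_avoiding _ _ _ _ (contractTime_surjective pz z)
  · intro u v h
    rcases ((SimpleGraph.fromRel_adj _ _ _).mp h).2 with h | h
    · exact strandRel_contractTime z h
    · exact (strandRel_contractTime z h).symm
  · intro a c h
    obtain ⟨hne, h⟩ := (SimpleGraph.fromRel_adj _ _ _).mp h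
    rcases h with h | h
    · obtain ⟨u, v, rfl, rfl, h'⟩ := exists_strandRel_lift z h
      exact ⟨u, v, rfl, rfl, (SimpleGraph.fromRel_adj _ _ _).mpr
        ⟨fun huv => hne (huv ▸ rfl), Or.inl h'⟩⟩
    · obtain ⟨u, v, rfl, rfl, h'⟩ := exists_strandRel_lift z h
      exact ⟨v, u, rfl, rfl, (SimpleGraph.fromRel_adj _ _ _).mpr
        ⟨fun huv => hne (huv ▸ rfl), Or.inr h'⟩⟩
  · rintro ⟨a, i, hi⟩ ⟨c, j, hj⟩ h
    obtain rfl : a = c := congrArg Prod.fst h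
    rcases le_total i j with hij | hij
    · obtain ⟨d, rfl⟩ := Nat.exists_eq_add_of_le hij
      rcases reachable_or_ends_of_contractTime_eq z a i d hj h with h | h
      · exact Or.inl h
      · exact Or.inr h.1
    · obtain ⟨d, rfl⟩ := Nat.exists_eq_add_of_le hij
      rcases reachable_or_ends_of_contractTime_eq z a j d hi h.symm with h | h
      · exact Or.inl h.symm
      · exact Or.inr h.2

theorem mem_image_strandEnds_iff (hz : ∀ e ∈ z, e ∈ E ∪ EF ∨ ∃ k : V, e = ({k} : Finset V))
    (h2 : ∀ e ∈ E ∪ EF, e.card = 2) (v : V × Fin ((z.filter pz).length + 1)) :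
    v ∈ contractTime pz z '' strandEnds E EF z.length z.get ↔
      ((v.2 : ℕ) = 0 ∨ (v.2 : ℕ) = (z.filter pz).length) ∨
      ∃ n : Fin z.length, ∃ k : V, z.get n = ({k} : Finset V) ∧
        v = contractTime pz z (k, n.castSucc) := by
  constructor
  · rintro ⟨⟨a, i⟩, h | h | ⟨t, h1, h3, h⟩, rfl⟩
    · exact Or.inl (Or.inl (by simp_all [contractTime]))
    · exact Or.inl (Or.inr (by simp_all [contractTime]))
    · obtain ⟨k, hk⟩ := (hz _ (List.get_mem z t)).resolve_left h1
      rw [hk] at h3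
      obtain rfl : a = k := Finset.mem_singleton.mp h3
      refine Or.inr ⟨t, a, hk, ?_⟩
      rcases h with h | h <;> dsimp only at h <;> subst h
      · rfl
      · exact contractTime_succ_of_notMem z t h1 a
  · rintro ((h | h) | ⟨n, k, hk, rfl⟩)
    · refine ⟨(v.1, 0), Or.inl rfl, ?_⟩
      exact Prod.ext rfl (Fin.ext (by simp [contractTime, h]))
    · refine ⟨(v.1, Fin.last _), Or.inr (Or.inl rfl), ?_⟩
      exact Prod.ext rfl (Fin.ext (by simp [contractTime, h]))
    · refine ⟨_, Or.inr (Or.inr ⟨n, fun h => ?_, ?_, Or.inl rfl⟩), rfl⟩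
      · have := h2 _ h
        rw [hk] at this
        simp at this
      · rw [hk]
        exact Finset.mem_singleton_self k

end Contract

/-- Let `q(z)` be obtained from `z` by deleting all vertex operators,
`k(z)` the number of vertex operators of `z`, and `ℓ(z)` the number of closed loops of
`q(z)` (components of `G_{q(z)}` containing no boundary vertex) containing the vertex
`(i_m, p_m − m)` associated to some vertex operator of `z` (the `m`-th vertex operator,
at position `p_m`, at site `i_m`; `p_m − m` is the number of non-vertex operators
strictly before it).  Then `L(z) = L(q(z)) + k(z) − ℓ(z)`. -/
theorem loops_after_removing_vertex_operators [Fintype V] [DecidableEq V]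
    (A : Finset V) (E EF : Finset (Finset V))
    (hE : ∀ e ∈ E, ∃ i j : V, i ∈ A ∧ j ∉ A ∧ e = {i, j})
    (hEF : ∀ e ∈ EF, ∃ i j : V, i ≠ j ∧ ((i ∈ A ∧ j ∈ A) ∨ (i ∉ A ∧ j ∉ A)) ∧ e = {i, j})
    (z : List (Finset V))
    (hz : ∀ e ∈ z, e ∈ E ∪ EF ∨ ∃ k : V, e = ({k} : Finset V)) :
    (numLoopsL E EF z : ℤ) =
      numLoopsL E EF (z.filter (fun e => e ∈ E ∪ EF))
      + (z.filter (fun e => e ∉ E ∪ EF)).length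
      - Set.ncard {c : (strandGraph E EF (z.filter (fun e => e ∈ E ∪ EF)).length
            (z.filter (fun e => e ∈ E ∪ EF)).get).ConnectedComponent |
          (∀ v ∈ c.supp, ¬((v.2 : ℕ) = 0 ∨ (v.2 : ℕ) = (z.filter (fun e => e ∈ E ∪ EF)).length)) ∧
          ∃ n : Fin z.length, ∃ k : V, z.get n = ({k} : Finset V) ∧
            ∃ h : ((z.take (n : ℕ)).filter (fun e => e ∈ E ∪ EF)).length <
                (z.filter (fun e => e ∈ E ∪ EF)).length + 1,
              (k, (⟨((z.take (n : ℕ)).filter (fun e => e ∈ E ∪ EF)).length, h⟩ :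
                  Fin ((z.filter (fun e => e ∈ E ∪ EF)).length + 1))) ∈ c.supp} := by
  have h2E : ∀ e ∈ E, e.card = 2 := by
    intro e he
    obtain ⟨i, j, hi, hj, rfl⟩ := hE e he
    exact Finset.card_pair fun h => hj (h ▸ hi)
  have h2 : ∀ e ∈ E ∪ EF, e.card = 2 := by
    intro e he
    rcases Finset.mem_union.mp he with he | he
    · exact h2E e he
    · obtain ⟨i, j, hij, -, rfl⟩ := hEF e he
      exact Finset.card_pair hij
  have hdisj : Disjoint E EF := by
    rw [Finset.disjoint_left]
    intro e he he'
    obtain ⟨i, j, hi, hj, rfl⟩ := hE e he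
    obtain ⟨a, c, -, hac, h⟩ := hEF _ he'
    have hi' : i ∈ ({a, c} : Finset V) := h ▸ by simp
    have hj' : j ∈ ({a, c} : Finset V) := h ▸ by simp
    simp only [Finset.mem_insert, Finset.mem_singleton] at hi' hj'
    rcases hi' with rfl | rfl <;> rcases hj' with rfl | rfl <;> tauto
  have hq : ∀ t, (z.filter fun e => e ∈ E ∪ EF).get t ∈ E ∪ EF := fun t => by
    simpa only [decide_eq_true_eq] using List.of_mem_filter (List.get_mem _ t)
  have hLz := numLoops_eq h2 hdisj z.get fun t => hz _ (List.get_mem z t)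
  have hLq := numLoops_eq h2 hdisj (z.filter fun e => e ∈ E ∪ EF).get fun t => Or.inl (hq t)
  have hk := card_filter_get (fun e => decide (e ∉ E ∪ EF)) z
  have hk0 : (Finset.univ.filter fun t => (z.filter fun e => e ∈ E ∪ EF).get t ∉ E ∪ EF).card = 0 :=
    Finset.card_eq_zero.mpr (Finset.filter_eq_empty_iff.mpr fun t _ => not_not.mpr (hq t))
  have hends : ∀ v, v ∈ strandEnds E EF _ (z.filter fun e => e ∈ E ∪ EF).get ↔
      ((v.2 : ℕ) = 0 ∨ (v.2 : ℕ) = (z.filter (fun e => e ∈ E ∪ EF)).length) := by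
    intro v
    simp only [strandEnds, Set.mem_ofPred_eq, hq, not_true_eq_false, false_and, exists_false,
      or_false, Fin.ext_iff, Fin.val_zero, Fin.val_last]
  rw [ncard_components_contractTime] at hLz
  simp only [decide_eq_true_eq] at hk
  rw [hk] at hLz
  rw [hk0] at hLq
  simp only [hends] at hLq
  simp only [mem_image_strandEnds_iff z hz h2] at hLz
  set B : Set (strandGraph E EF (z.filter (fun e => e ∈ E ∪ EF)).length
    (z.filter (fun e => e ∈ E ∪ EF)).get).ConnectedComponent := {c | ∀ v ∈ c.supp,
      ¬((v.2 : ℕ) = 0 ∨ (v.2 : ℕ) = (z.filter (fun e => e ∈ E ∪ EF)).length)} with hB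
  set T : Set (strandGraph E EF (z.filter (fun e => e ∈ E ∪ EF)).length
    (z.filter (fun e => e ∈ E ∪ EF)).get).ConnectedComponent :=
      {c | ∃ n : Fin z.length, ∃ k : V, z.get n = ({k} : Finset V) ∧
        contractTime (fun e => decide (e ∈ E ∪ EF)) z (k, n.castSucc) ∈ c.supp} with hT
  have hLz' : numLoops E EF z.length z.get =
      Fintype.card V + (z.filter (fun e => e ∉ E ∪ EF)).length + (B \ T).ncard := by
    rw [hLz]
    congr 2
    ext c
    simp only [hB, hT, Set.mem_ofPred_eq, Set.mem_sdiff, not_or, not_exists, not_and]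
    constructor
    · intro h
      exact ⟨fun v hv => (h v hv).1, fun n k hk hc => (h _ hc).2 n k hk rfl⟩
    · rintro ⟨h, h'⟩ v hv
      exact ⟨h v hv, fun n k hk hc => h' n k hk (hc ▸ hv)⟩
  have harith : ∀ a b c d e : ℕ, e = d →
      ((a + b + c : ℕ) : ℤ) = ((a + 0 + (d + c) : ℕ) : ℤ) + b - e := by
    intros
    omega
  unfold numLoopsL
  rw [hLz', hLq, ← Set.ncard_inter_add_ncard_sdiff_eq_ncard B T (Set.toFinite _)]
  refine harith _ _ _ _ _ ?_
  congr 1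
  ext c
  refine and_congr Iff.rfl ?_
  constructor
  · rintro ⟨n, k, hk, _, hc⟩
    exact ⟨n, k, hk, hc⟩
  · rintro ⟨n, k, hk, hc⟩
    exact ⟨n, k, hk, _, hc⟩
end

section
/- Consider the Metropolis Markov chain P of the stochastic power expansion QMC on the state space Ω = 𝒪^{2B}, where 𝒪 = ℰ ∪ ℰ_F ∪ 𝒱_X is the set of local operators, with stationary distribution π(x) = 2^{L(x)} ∏_{k=1}^{2B} T(x_k) / Z. Assume 1 ≤ |𝒜| ≤ |ℬ| and that the number of local operators satisfies |𝒪| ≤ 3N. Let T_max and T_min be the largest and smallest values of the coupling function T on 𝒪. Then the second-largest eigenvalue λ₂ of the (real, reversible) transition matrix P satisfies 1 − λ₂ ≥ (12 B² N (T_max/T_min) 2^{8|𝒜|−4})^{−1}. -/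
open SimpleGraph

variable {V : Type*}

variable [Fintype V] [DecidableEq V]

/-- The unnormalized weight `2^{L(x)} ∏_k T(x_k)` of a configuration. -/
noncomputable def confWt (E EF O : Finset (Finset V)) (B : ℕ)
    (T : {e : Finset V // e ∈ O} → ℝ) (x : Fin (2 * B) → {e : Finset V // e ∈ O}) : ℝ :=
  2 ^ numLoops E EF (2 * B) (fun t => (x t : Finset V)) * ∏ k, T (x k)

/-- The stationary distribution `π(x) = 2^{L(x)} ∏_k T(x_k) / Z`. -/
noncomputable def piDist (E EF O : Finset (Finset V)) (B : ℕ)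
    (T : {e : Finset V // e ∈ O} → ℝ) (x : Fin (2 * B) → {e : Finset V // e ∈ O}) : ℝ :=
  confWt E EF O B T x / ∑ y : Fin (2 * B) → {e : Finset V // e ∈ O}, confWt E EF O B T y

/-- Off-diagonal Metropolis transition probabilities: `(2B|𝒪|)⁻¹ min{1, π(y)/π(x)}`
if `y` differs from `x` in exactly one slot, `0` otherwise. -/
noncomputable def offDiag (E EF O : Finset (Finset V)) (B : ℕ)
    (T : {e : Finset V // e ∈ O} → ℝ)
    (x y : Fin (2 * B) → {e : Finset V // e ∈ O}) : ℝ :=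
  if x ≠ y ∧ ∃ k, ∀ j, j ≠ k → x j = y j then
    (1 / (2 * B * O.card)) * min 1 (piDist E EF O B T y / piDist E EF O B T x)
  else 0

/-- The Metropolis transition matrix of the SPE Markov chain. -/
noncomputable def transP (E EF O : Finset (Finset V)) (B : ℕ)
    (T : {e : Finset V // e ∈ O} → ℝ)
    (x y : Fin (2 * B) → {e : Finset V // e ∈ O}) : ℝ :=
  if x = y then 1 - ∑ y', offDiag E EF O B T x y' else offDiag E EF O B T x y

/-- If every `H`-edge leaving `S` or inside `S` is a `G`-edge, then `H` has at least as many
components inside `S` as `G`. -/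
lemma ncard_components_subset_le {W : Type*} [Finite W] (G H : SimpleGraph W) (S : Set W)
    (h : ∀ p ∈ S, ∀ q, H.Adj p q → G.Adj p q) :
    {C : G.ConnectedComponent | C.supp ⊆ S}.ncard ≤
      {C : H.ConnectedComponent | C.supp ⊆ S}.ncard := by
  have key : ∀ C : G.ConnectedComponent, C.supp ⊆ S →
      ∀ q, H.Reachable (Quot.out C) q → G.connectedComponentMk q = C := by
    intro C hC q hq
    rw [SimpleGraph.reachable_iff_reflTransGen] at hq
    induction hq with
    | refl => exact Quot.out_eq C
    | tail _ hab ih =>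
      rw [← ih]
      exact SimpleGraph.ConnectedComponent.sound (h _ (hC ih) _ hab).symm.reachable
  refine Set.ncard_le_ncard_of_injOn (fun C => H.connectedComponentMk (Quot.out C)) ?_ ?_
    (Set.toFinite _)
  · intro C hC q hq
    exact hC (key C hC q (SimpleGraph.ConnectedComponent.exact hq).symm)
  · intro C hC C' _ hCC'
    have := key C hC _ (SimpleGraph.ConnectedComponent.exact hCC')
    exact this.symm.trans (Quot.out_eq C')

lemma strandGraph_adj_time_le {V : Type*} {E EF : Finset (Finset V)} {n : ℕ} {x : Fin n → Finset V}
    {p q : V × Fin (n + 1)} (h : (strandGraph E EF n x).Adj p q) :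
    (p.2 : ℕ) ≤ q.2 + 1 ∧ (q.2 : ℕ) ≤ p.2 + 1 := by
  have aux : ∀ a b : V × Fin (n + 1), strandRel E EF n x a b →
      (a.2 : ℕ) ≤ b.2 + 1 ∧ (b.2 : ℕ) ≤ a.2 + 1 := by
    rintro a b ⟨t, ⟨-, -, h1, h2⟩ | ⟨-, -, -, -, ⟨h1, h2⟩ | ⟨h1, h2⟩⟩ | ⟨-, -, -, -, h1, h2⟩⟩ <;>
      simp [h1, h2] <;> omega
  rcases (SimpleGraph.fromRel_adj _ _ _).1 h with ⟨-, h | h⟩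
  · exact aux _ _ h
  · exact (aux _ _ h).symm

/-- Components of the strand graph meeting time layer `k`. -/
def touching {V : Type*} (E EF : Finset (Finset V)) (n : ℕ) (x : Fin n → Finset V)
    (k : Fin (n + 1)) : Set (strandGraph E EF n x).ConnectedComponent :=
  Set.range fun v => (strandGraph E EF n x).connectedComponentMk (v, k)

lemma numLoops_eq_add {V : Type*} [Finite V] (E EF : Finset (Finset V)) (n : ℕ)
    (x : Fin n → Finset V) (k : Fin (n + 1)) :
    numLoops E EF n x = (touching E EF n x k).ncard +
      ({C : (strandGraph E EF n x).ConnectedComponent | C.supp ⊆ {p | p.2 < k}}.ncard +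
       {C : (strandGraph E EF n x).ConnectedComponent | C.supp ⊆ {p | k < p.2}}.ncard) := by
  rw [← Set.ncard_union_eq, ← Set.ncard_union_eq, numLoops, ← Set.ncard_univ]
  · congr 1
    refine (Set.eq_univ_of_forall fun C => ?_).symm
    by_cases hC : C ∈ touching E EF n x k
    · exact Or.inl hC
    right
    have hne : ∀ q : V × Fin (n + 1), q ∈ C.supp → q.2 ≠ k := by
      rintro ⟨v, t⟩ hq rfl
      exact hC ⟨v, hq⟩
    induction C using SimpleGraph.ConnectedComponent.ind with
    | _ p =>
    have reach : ∀ P : V × Fin (n + 1) → Prop, P p →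
        (∀ a b, P a → b.2 ≠ k → (strandGraph E EF n x).Adj a b → P b) →
        ((strandGraph E EF n x).connectedComponentMk p).supp ⊆ {q | P q} := by
      intro P hp hstep q hq
      have hq' := (SimpleGraph.ConnectedComponent.exact hq).symm
      rw [SimpleGraph.reachable_iff_reflTransGen] at hq'
      clear hq
      induction hq' with
      | refl => exact hp
      | tail h1 hab ih =>
        refine hstep _ _ ih (hne _ ?_) hab
        rw [← SimpleGraph.reachable_iff_reflTransGen] at h1
        exact SimpleGraph.ConnectedComponent.sound (h1.trans hab.reachable).symm
    rcases lt_or_gt_of_ne (hne p rfl) with hp | hp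
    · refine Or.inl (reach _ hp fun a b ha hb hab => ?_)
      have := strandGraph_adj_time_le hab
      have hb' : (b.2 : ℕ) ≠ k := fun h => hb (Fin.ext h)
      rw [Fin.lt_def] at *
      omega
    · refine Or.inr (reach _ hp fun a b ha hb hab => ?_)
      have := strandGraph_adj_time_le hab
      have hb' : (b.2 : ℕ) ≠ k := fun h => hb (Fin.ext h)
      simp only [gt_iff_lt, Fin.lt_def] at *
      omega
  · rw [Set.disjoint_left]
    rintro C ⟨v, rfl⟩ (h | h)
    · exact lt_irrefl k (show k < k from h rfl)
    · exact lt_irrefl k (show k < k from h rfl)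
  · rw [Set.disjoint_left]
    intro C h1 h2
    induction C using SimpleGraph.ConnectedComponent.ind with
    | _ p => exact lt_asymm (show p.2 < k from h1 rfl) (show k < p.2 from h2 rfl)

lemma ncard_touching_le {V : Type*} [Fintype V] (E EF : Finset (Finset V)) (n : ℕ)
    (x : Fin n → Finset V) (k : Fin (n + 1)) :
    (touching E EF n x k).ncard ≤ Fintype.card V := by
  rw [touching, ← Set.image_univ, ← Nat.card_eq_fintype_card, ← Set.ncard_univ]
  exact Set.ncard_image_le

/-- One step along a strand, oriented forwards in time on sites outside `A` and backwards on
sites of `A`. -/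
def strandStep {V : Type*} [DecidableEq V] (A : Finset V) (E EF : Finset (Finset V)) (n : ℕ)
    (x : Fin n → Finset V) (p q : V × Fin (n + 1)) : Prop :=
  ∃ t : Fin n,
    ((p.1 = q.1 ∧ p.1 ∉ x t) ∨
      ((x t ∈ E ∨ x t ∈ EF) ∧ p.1 ∈ x t ∧ q.1 ∈ x t ∧ p.1 ≠ q.1)) ∧
    p.2 = (if p.1 ∈ A then Fin.succ t else Fin.castSucc t) ∧
    q.2 = (if q.1 ∈ A then Fin.castSucc t else Fin.succ t)

section Step

variable {V : Type*} [DecidableEq V] {A : Finset V} {E EF : Finset (Finset V)} {n : ℕ}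
  {x : Fin n → Finset V}

lemma eq_of_mem_of_ne {e : Finset V} {i j v w w' : V} (he : e = {i, j}) (hv : v ∈ e) (hw : w ∈ e)
    (hw' : w' ∈ e) (h : v ≠ w) (h' : v ≠ w') : w = w' := by
  subst he
  simp only [Finset.mem_insert, Finset.mem_singleton] at *
  grind

lemma strandStep_right_unique (h2 : ∀ e, e ∈ E ∨ e ∈ EF → ∃ i j : V, e = {i, j})
    {p q q' : V × Fin (n + 1)} (h : strandStep A E EF n x p q) (h' : strandStep A E EF n x p q') :
    q = q' := by
  obtain ⟨t, hm, hp, hq⟩ := h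
  obtain ⟨t', hm', hp', hq'⟩ := h'
  have ht : t = t' := by
    rw [hp] at hp'
    split_ifs at hp'
    · exact Fin.succ_injective _ hp'
    · exact Fin.castSucc_injective _ hp'
  subst ht
  have h1 : q.1 = q'.1 := by
    rcases hm with ⟨a, b⟩ | ⟨he, a, b, c⟩ <;> rcases hm' with ⟨a', b'⟩ | ⟨he', a', b', c'⟩
    · exact a.symm.trans a'
    · exact absurd a' b
    · exact absurd a b'
    · obtain ⟨i, j, hij⟩ := h2 _ he
      exact eq_of_mem_of_ne hij a b b' c c'
  exact Prod.ext h1 (by rw [hq, hq', h1])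

lemma strandStep_left_unique (h2 : ∀ e, e ∈ E ∨ e ∈ EF → ∃ i j : V, e = {i, j})
    {p p' q : V × Fin (n + 1)} (h : strandStep A E EF n x p q) (h' : strandStep A E EF n x p' q) :
    p = p' := by
  obtain ⟨t, hm, hp, hq⟩ := h
  obtain ⟨t', hm', hp', hq'⟩ := h'
  have ht : t = t' := by
    rw [hq] at hq'
    split_ifs at hq'
    · exact Fin.castSucc_injective _ hq'
    · exact Fin.succ_injective _ hq'
  subst ht
  have h1 : p.1 = p'.1 := by
    rcases hm with ⟨a, b⟩ | ⟨he, a, b, c⟩ <;> rcases hm' with ⟨a', b'⟩ | ⟨he', a', b', c'⟩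
    · exact a.trans a'.symm
    · exact absurd (a ▸ b') b
    · exact absurd (a' ▸ b) b'
    · obtain ⟨i, j, hij⟩ := h2 _ he
      exact eq_of_mem_of_ne hij b a a' c.symm c'.symm
  exact Prod.ext h1 (by rw [hp, hp', h1])

lemma mem_iff_notMem_of_afm {e : Finset V} (he : ∃ i j : V, i ∈ A ∧ j ∉ A ∧ e = {i, j})
    {v w : V} (hv : v ∈ e) (hw : w ∈ e) (h : v ≠ w) : v ∈ A ↔ w ∉ A := by
  obtain ⟨i, j, hi, hj, rfl⟩ := he
  simp only [Finset.mem_insert, Finset.mem_singleton] at *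
  grind

lemma mem_iff_mem_of_fm {e : Finset V}
    (he : ∃ i j : V, i ≠ j ∧ ((i ∈ A ∧ j ∈ A) ∨ (i ∉ A ∧ j ∉ A)) ∧ e = {i, j})
    {v w : V} (hv : v ∈ e) (hw : w ∈ e) : v ∈ A ↔ w ∈ A := by
  obtain ⟨i, j, -, hij, rfl⟩ := he
  simp only [Finset.mem_insert, Finset.mem_singleton] at *
  grind

lemma strandStep_or_of_strandRel (hE : ∀ e ∈ E, ∃ i j : V, i ∈ A ∧ j ∉ A ∧ e = {i, j})
    (hEF : ∀ e ∈ EF, ∃ i j : V, i ≠ j ∧ ((i ∈ A ∧ j ∈ A) ∨ (i ∉ A ∧ j ∉ A)) ∧ e = {i, j})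
    {p q : V × Fin (n + 1)} (h : strandRel E EF n x p q) :
    strandStep A E EF n x p q ∨ strandStep A E EF n x q p := by
  obtain ⟨t, ⟨h1, h2, h3, h4⟩ | ⟨h0, h1, h2, h3, h4⟩ | ⟨h0, h1, h2, h3, h4, h5⟩⟩ := h
  · by_cases hA : p.1 ∈ A
    · exact Or.inr ⟨t, Or.inl ⟨h1.symm, h1 ▸ h2⟩, by simp [← h1, hA, h4], by simp [hA, h3]⟩
    · exact Or.inl ⟨t, Or.inl ⟨h1, h2⟩, by simp [hA, h3], by simp [← h1, hA, h4]⟩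
  · have hpq := mem_iff_notMem_of_afm (hE _ h0) h1 h2 h3
    by_cases hA : p.1 ∈ A
    · have hq := hpq.1 hA
      rcases h4 with ⟨h4, h5⟩ | ⟨h4, h5⟩
      · exact Or.inr ⟨t, Or.inr ⟨Or.inl h0, h2, h1, h3.symm⟩, by simp [hq, h5], by simp [hA, h4]⟩
      · exact Or.inl ⟨t, Or.inr ⟨Or.inl h0, h1, h2, h3⟩, by simp [hA, h4], by simp [hq, h5]⟩
    · have hq : q.1 ∈ A := by tauto
      rcases h4 with ⟨h4, h5⟩ | ⟨h4, h5⟩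
      · exact Or.inl ⟨t, Or.inr ⟨Or.inl h0, h1, h2, h3⟩, by simp [hA, h4], by simp [hq, h5]⟩
      · exact Or.inr ⟨t, Or.inr ⟨Or.inl h0, h2, h1, h3.symm⟩, by simp [hq, h5], by simp [hA, h4]⟩
  · have hpq := mem_iff_mem_of_fm (hEF _ h0) h1 h2
    by_cases hA : p.1 ∈ A
    · exact Or.inr ⟨t, Or.inr ⟨Or.inr h0, h2, h1, h3.symm⟩, by simp [← hpq, hA, h5],
        by simp [hA, h4]⟩
    · exact Or.inl ⟨t, Or.inr ⟨Or.inr h0, h1, h2, h3⟩, by simp [hA, h4], by simp [← hpq, hA, h5]⟩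

lemma strandRel_or_of_strandStep (hE : ∀ e ∈ E, ∃ i j : V, i ∈ A ∧ j ∉ A ∧ e = {i, j})
    (hEF : ∀ e ∈ EF, ∃ i j : V, i ≠ j ∧ ((i ∈ A ∧ j ∈ A) ∨ (i ∉ A ∧ j ∉ A)) ∧ e = {i, j})
    {p q : V × Fin (n + 1)} (h : strandStep A E EF n x p q) :
    strandRel E EF n x p q ∨ strandRel E EF n x q p := by
  obtain ⟨t, ⟨h1, h2⟩ | ⟨h0 | h0, h1, h2, h3⟩, hp, hq⟩ := h
  · by_cases hA : p.1 ∈ A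
    · rw [← h1] at hq
      simp only [hA, if_true] at hp hq
      exact Or.inr ⟨t, Or.inl ⟨h1.symm, h1 ▸ h2, hq, hp⟩⟩
    · rw [← h1] at hq
      simp only [hA, if_false] at hp hq
      exact Or.inl ⟨t, Or.inl ⟨h1, h2, hp, hq⟩⟩
  · have hpq := mem_iff_notMem_of_afm (hE _ h0) h1 h2 h3
    refine Or.inl ⟨t, Or.inr (Or.inl ⟨h0, h1, h2, h3, ?_⟩)⟩
    by_cases hA : p.1 ∈ A
    · have hq' := hpq.1 hA
      exact Or.inr ⟨by simpa [hA] using hp, by simpa [hq'] using hq⟩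
    · have hq' : q.1 ∈ A := by tauto
      exact Or.inl ⟨by simpa [hA] using hp, by simpa [hq'] using hq⟩
  · have hpq := mem_iff_mem_of_fm (hEF _ h0) h1 h2
    by_cases hA : p.1 ∈ A
    · exact Or.inr ⟨t, Or.inr (Or.inr ⟨h0, h2, h1, h3.symm, by simpa [← hpq, hA] using hq,
        by simpa [hA] using hp⟩)⟩
    · exact Or.inl ⟨t, Or.inr (Or.inr ⟨h0, h1, h2, h3, by simpa [hA] using hp,
        by simpa [← hpq, hA] using hq⟩)⟩

lemma reachable_of_strandStep (hE : ∀ e ∈ E, ∃ i j : V, i ∈ A ∧ j ∉ A ∧ e = {i, j})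
    (hEF : ∀ e ∈ EF, ∃ i j : V, i ≠ j ∧ ((i ∈ A ∧ j ∈ A) ∨ (i ∉ A ∧ j ∉ A)) ∧ e = {i, j})
    {p q : V × Fin (n + 1)} (h : strandStep A E EF n x p q) :
    (strandGraph E EF n x).Reachable p q := by
  by_cases hpq : p = q
  · rw [hpq]
  · exact ((SimpleGraph.fromRel_adj _ _ _).2
      ⟨hpq, strandRel_or_of_strandStep hE hEF h⟩ :
        (strandGraph E EF n x).Adj p q).reachable

/-- Each strand has at most one endpoint without outgoing step. -/
lemma sink_unique (hE : ∀ e ∈ E, ∃ i j : V, i ∈ A ∧ j ∉ A ∧ e = {i, j})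
    (hEF : ∀ e ∈ EF, ∃ i j : V, i ≠ j ∧ ((i ∈ A ∧ j ∈ A) ∨ (i ∉ A ∧ j ∉ A)) ∧ e = {i, j})
    (h2 : ∀ e, e ∈ E ∨ e ∈ EF → ∃ i j : V, e = {i, j})
    {p q : V × Fin (n + 1)} (h : (strandGraph E EF n x).Reachable p q)
    (hp : ∀ r, ¬ strandStep A E EF n x p r) (hq : ∀ r, ¬ strandStep A E EF n x q r) : p = q := by
  have eqv : Equivalence (Relation.Join (Relation.ReflTransGen (strandStep A E EF n x))) :=
    Relation.equivalence_join_reflTransGen fun a b c hab hac =>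
      ⟨b, Relation.ReflGen.refl, by rw [strandStep_right_unique h2 hab hac]⟩
  have step : ∀ {a b}, strandStep A E EF n x a b →
      Relation.Join (Relation.ReflTransGen (strandStep A E EF n x)) a b := fun {a b} hab =>
    ⟨b, Relation.ReflTransGen.single hab, Relation.ReflTransGen.refl⟩
  have hj : Relation.Join (Relation.ReflTransGen (strandStep A E EF n x)) p q := by
    rw [SimpleGraph.reachable_iff_reflTransGen] at h
    clear hq
    induction h with
    | refl => exact eqv.refl _
    | tail _ hab ih =>
      refine eqv.trans ih ?_
      rcases (SimpleGraph.fromRel_adj _ _ _).1 hab with ⟨-, h | h⟩ <;>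
        rcases strandStep_or_of_strandRel hE hEF h with h | h
      · exact step h
      · exact eqv.symm (step h)
      · exact eqv.symm (step h)
      · exact step h
  obtain ⟨r, hpr, hqr⟩ := hj
  have e1 := (Relation.ReflTransGen.cases_head_iff.1 hpr).resolve_right fun ⟨c, hc, _⟩ => hp c hc
  have e2 := (Relation.ReflTransGen.cases_head_iff.1 hqr).resolve_right fun ⟨c, hc, _⟩ => hq c hc
  exact e1.trans e2.symm

lemma card_compl_le_card_add_ncard_touching [Fintype V]
    (hE : ∀ e ∈ E, ∃ i j : V, i ∈ A ∧ j ∉ A ∧ e = {i, j})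
    (hEF : ∀ e ∈ EF, ∃ i j : V, i ≠ j ∧ ((i ∈ A ∧ j ∈ A) ∨ (i ∉ A ∧ j ∉ A)) ∧ e = {i, j})
    (x : Fin n → Finset V) (k : Fin (n + 1)) :
    Aᶜ.card ≤ A.card + (touching E EF n x k).ncard := by
  classical
  have h2 : ∀ e, e ∈ E ∨ e ∈ EF → ∃ i j : V, e = {i, j} := by
    rintro e (he | he)
    · obtain ⟨i, j, -, -, h⟩ := hE e he
      exact ⟨i, j, h⟩
    · obtain ⟨i, j, -, -, h⟩ := hEF e he
      exact ⟨i, j, h⟩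
  let mk := (strandGraph E EF n x).connectedComponentMk
  let M : Finset (V × Fin (n + 1)) :=
    Finset.univ.filter fun p => mk p ∈ touching E EF n x k ∧ k < p.2
  let layer : Finset V → Finset (V × Fin (n + 1)) := fun S => S ×ˢ {k}
  have hdisj : ∀ S, Disjoint M (layer S) := by
    intro S
    rw [Finset.disjoint_left]
    intro p hp hp'
    have h1 : k < p.2 := (Finset.mem_filter.1 hp).2.2
    have h2 : p.2 = k := Finset.mem_singleton.1 (Finset.mem_product.1 hp').2
    exact absurd h2 h1.ne'
  have hcard : ∀ S, (M ∪ layer S).card = M.card + S.card := by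
    intro S
    rw [Finset.card_union_of_disjoint (hdisj S), Finset.card_product, Finset.card_singleton,
      mul_one]
  have htouch : ∀ S, ∀ p ∈ M ∪ layer S, mk p ∈ touching E EF n x k := by
    intro S p hp
    rcases Finset.mem_union.1 hp with hp | hp
    · exact (Finset.mem_filter.1 hp).2.1
    · have h2 : p.2 = k := Finset.mem_singleton.1 (Finset.mem_product.1 hp).2
      exact ⟨p.1, by rw [← h2]⟩
  have hsplit := Finset.card_filter_add_card_filter_not (s := M ∪ layer Aᶜ)
    (fun p => ∃ q, strandStep A E EF n x p q)
  have hsink : ((M ∪ layer Aᶜ).filter fun p => ¬ ∃ q, strandStep A E EF n x p q).card ≤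
      (touching E EF n x k).ncard := by
    rw [Set.ncard_eq_toFinset_card _ (Set.toFinite _)]
    refine Finset.card_le_card_of_injOn mk ?_ ?_
    · intro p hp
      simpa using htouch _ p (Finset.mem_filter.1 hp).1
    · intro p hp q hq hpq
      exact sink_unique hE hEF h2 (SimpleGraph.ConnectedComponent.exact hpq)
        (not_exists.1 (Finset.mem_filter.1 hp).2) (not_exists.1 (Finset.mem_filter.1 hq).2)
  have hflow : ((M ∪ layer Aᶜ).filter fun p => ∃ q, strandStep A E EF n x p q).card ≤
      (M ∪ layer A).card := by
    refine Finset.card_le_card_of_injOn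
      (fun p => if h : ∃ q, strandStep A E EF n x p q then h.choose else p) ?_ ?_
    · intro p hp
      obtain ⟨hp, hs⟩ := Finset.mem_filter.1 hp
      simp only [hs, dif_pos]
      have hspec := hs.choose_spec
      generalize hs.choose = q at hspec
      have hq : mk q ∈ touching E EF n x k := by
        have : mk q = mk p :=
          SimpleGraph.ConnectedComponent.sound (reachable_of_strandStep hE hEF hspec).symm
        rw [this]
        exact htouch _ p hp
      obtain ⟨t, -, h3, h4⟩ := hspec
      have ht : (k : ℕ) ≤ t := by
        rcases Finset.mem_union.1 hp with hp | hp
        · have h1 : k < p.2 := (Finset.mem_filter.1 hp).2.2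
          rw [h3, Fin.lt_def] at h1
          split_ifs at h1 <;> simp at h1 <;> omega
        · obtain ⟨ha, hb⟩ := Finset.mem_product.1 hp
          rw [if_neg (Finset.mem_compl.1 ha)] at h3
          rw [← Finset.mem_singleton.1 hb, h3]
          rfl
      simp only [Finset.coe_union, Set.mem_union, Finset.mem_coe]
      by_cases hA : q.1 ∈ A
      · rw [if_pos hA] at h4
        rcases ht.eq_or_lt with ht | ht
        · right
          refine Finset.mem_product.2 ⟨hA, Finset.mem_singleton.2 (Fin.ext ?_)⟩
          simp [h4, ht]
        · left
          refine Finset.mem_filter.2 ⟨Finset.mem_univ _, hq, ?_⟩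
          simpa [h4, Fin.lt_def] using ht
      · rw [if_neg hA] at h4
        left
        refine Finset.mem_filter.2 ⟨Finset.mem_univ _, hq, ?_⟩
        simp [h4, Fin.lt_def]
        omega
    · intro p hp q hq hpq
      have hp' := (Finset.mem_filter.1 hp).2
      have hq' := (Finset.mem_filter.1 hq).2
      simp only [hp', hq', dif_pos] at hpq
      exact strandStep_left_unique h2 hp'.choose_spec (hpq ▸ hq'.choose_spec)
  rw [hcard] at hflow hsplit
  omega

end Step

/-- The configuration equal to `y` before slot `k` and to `x` from slot `k` on. -/
def hybrid {S : Type*} {n : ℕ} (k : ℕ) (x y : Fin n → S) : Fin n → S :=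
  fun t => if (t : ℕ) < k then y t else x t

lemma strandGraph_adj_congr_left {V : Type*} {E EF : Finset (Finset V)} {n : ℕ}
    {x y : Fin n → Finset V} (k : Fin (n + 1)) (hxy : ∀ t : Fin n, (t : ℕ) < k → x t = y t)
    (p : V × Fin (n + 1)) (hp : p.2 < k) (q : V × Fin (n + 1))
    (h : (strandGraph E EF n x).Adj p q) : (strandGraph E EF n y).Adj p q := by
  obtain ⟨hne, h⟩ := (SimpleGraph.fromRel_adj _ _ _).1 h
  refine (SimpleGraph.fromRel_adj _ _ _).2 ⟨hne, ?_⟩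
  rw [Fin.lt_def] at hp
  refine h.imp ?_ ?_ <;>
  · rintro ⟨t, ht⟩
    refine ⟨t, ?_⟩
    rw [← hxy t]
    · exact ht
    · rcases ht with ⟨-, -, h1, h2⟩ | ⟨-, -, -, -, ⟨h1, h2⟩ | ⟨h1, h2⟩⟩ | ⟨-, -, -, -, h1, h2⟩ <;>
        simp only [h1, h2, Fin.val_succ, Fin.val_castSucc] at hp <;> omega

lemma strandGraph_adj_congr_right {V : Type*} {E EF : Finset (Finset V)} {n : ℕ}
    {x y : Fin n → Finset V} (k : Fin (n + 1)) (hxy : ∀ t : Fin n, (k : ℕ) ≤ t → x t = y t)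
    (p : V × Fin (n + 1)) (hp : k < p.2) (q : V × Fin (n + 1))
    (h : (strandGraph E EF n x).Adj p q) : (strandGraph E EF n y).Adj p q := by
  obtain ⟨hne, h⟩ := (SimpleGraph.fromRel_adj _ _ _).1 h
  refine (SimpleGraph.fromRel_adj _ _ _).2 ⟨hne, ?_⟩
  rw [Fin.lt_def] at hp
  refine h.imp ?_ ?_ <;>
  · rintro ⟨t, ht⟩
    refine ⟨t, ?_⟩
    rw [← hxy t]
    · exact ht
    · rcases ht with ⟨-, -, h1, h2⟩ | ⟨-, -, -, -, ⟨h1, h2⟩ | ⟨h1, h2⟩⟩ | ⟨-, -, -, -, h1, h2⟩ <;>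
        simp only [h1, h2, Fin.val_succ, Fin.val_castSucc] at hp <;> omega

/-- Exchanging the operators before slot `k` between two configurations changes the total number
of loops by at most `4|A|`. -/
lemma numLoops_add_le {V : Type*} [Fintype V] [DecidableEq V] {A : Finset V}
    {E EF : Finset (Finset V)} {n : ℕ}
    (hE : ∀ e ∈ E, ∃ i j : V, i ∈ A ∧ j ∉ A ∧ e = {i, j})
    (hEF : ∀ e ∈ EF, ∃ i j : V, i ≠ j ∧ ((i ∈ A ∧ j ∈ A) ∨ (i ∉ A ∧ j ∉ A)) ∧ e = {i, j})
    (x y : Fin n → Finset V) (k : ℕ) (hk : k ≤ n) :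
    numLoops E EF n x + numLoops E EF n y ≤
      numLoops E EF n (hybrid k x y) + numLoops E EF n (hybrid k y x) + 4 * A.card := by
  let k' : Fin (n + 1) := ⟨k, by omega⟩
  have left : ∀ u v : Fin n → Finset V, (∀ t : Fin n, (t : ℕ) < k → u t = v t) →
      {C : (strandGraph E EF n u).ConnectedComponent | C.supp ⊆ {p | p.2 < k'}}.ncard ≤
      {C : (strandGraph E EF n v).ConnectedComponent | C.supp ⊆ {p | p.2 < k'}}.ncard :=
    fun u v huv => ncard_components_subset_le _ _ _ fun p hp q h =>
      strandGraph_adj_congr_left k' (fun t ht => (huv t ht).symm) p hp q h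
  have right : ∀ u v : Fin n → Finset V, (∀ t : Fin n, k ≤ (t : ℕ) → u t = v t) →
      {C : (strandGraph E EF n u).ConnectedComponent | C.supp ⊆ {p | k' < p.2}}.ncard ≤
      {C : (strandGraph E EF n v).ConnectedComponent | C.supp ⊆ {p | k' < p.2}}.ncard :=
    fun u v huv => ncard_components_subset_le _ _ _ fun p hp q h =>
      strandGraph_adj_congr_right k' (fun t ht => (huv t ht).symm) p hp q h
  have hl1 := left x (hybrid k y x) fun t ht => by simp [hybrid, ht]
  have hl2 := left y (hybrid k x y) fun t ht => by simp [hybrid, ht]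
  have hr1 := right x (hybrid k x y) fun t ht => by simp [hybrid, ht.not_gt]
  have hr2 := right y (hybrid k y x) fun t ht => by simp [hybrid, ht.not_gt]
  have ht1 := ncard_touching_le E EF n x k'
  have ht2 := ncard_touching_le E EF n y k'
  have hb1 := card_compl_le_card_add_ncard_touching hE hEF (hybrid k x y) k'
  have hb2 := card_compl_le_card_add_ncard_touching hE hEF (hybrid k y x) k'
  have hN := Finset.card_add_card_compl A
  rw [numLoops_eq_add E EF n x k', numLoops_eq_add E EF n y k',
    numLoops_eq_add E EF n (hybrid k x y) k', numLoops_eq_add E EF n (hybrid k y x) k']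
  omega

section Canonical

variable {S : Type*} {n : ℕ}

lemma hybrid_zero (x y : Fin n → S) : hybrid 0 x y = x := by
  ext t; simp [hybrid]

lemma hybrid_self (x y : Fin n → S) : hybrid n x y = y := by
  ext t; simp [hybrid]

lemma hybrid_hybrid (k : ℕ) (x y : Fin n → S) : hybrid k (hybrid k x y) (hybrid k y x) = x := by
  ext t
  by_cases h : (t : ℕ) < k <;> simp [hybrid, h]

lemma hybrid_succ (k : Fin n) (x y : Fin n → S) :
    hybrid (k + 1) x y = Function.update (hybrid k x y) k (hybrid k y x k) := by
  ext t
  by_cases h : t = k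
  · subst h
    simp [hybrid]
  · have h' : (t : ℕ) ≠ k := fun e => h (Fin.ext e)
    have h1 : (t : ℕ) < k + 1 ↔ (t : ℕ) < k := by omega
    simp [hybrid, h, h1]

/-- Exchanging the slots before `k`, as a permutation of pairs of configurations. -/
def exchange (k : ℕ) : Equiv.Perm ((Fin n → S) × (Fin n → S)) :=
  Function.Involutive.toPerm (fun p => (hybrid k p.1 p.2, hybrid k p.2 p.1)) fun p =>
    Prod.ext (hybrid_hybrid k p.1 p.2) (hybrid_hybrid k p.2 p.1)

variable [Fintype S] [DecidableEq S]

lemma sum_update_le (wt : (Fin n → S) → ℝ) (hwt : ∀ x, 0 ≤ wt x) (k : Fin n) (a b : S) :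
    ∑ w with w k = a, wt (Function.update w k b) ≤ ∑ w, wt w := by
  have hinj : Set.InjOn (fun w : Fin n → S => Function.update w k b)
      (Finset.univ.filter fun w : Fin n → S => w k = a) := by
    intro w hw w' hw' h
    ext t
    by_cases ht : t = k
    · rw [ht, (Finset.mem_filter.1 hw).2, (Finset.mem_filter.1 hw').2]
    · simpa [ht] using congrFun h t
  rw [← Finset.sum_image (f := wt) hinj]
  exact Finset.sum_le_sum_of_subset_of_nonneg (Finset.subset_univ _) fun x _ _ => hwt x

/-- Canonical paths: the slot-by-slot interpolation between configurations gives a Poincaré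
inequality for the single-slot Metropolis dynamics. -/
lemma canonical_path_bound (wt : (Fin n → S) → ℝ) (hwt : ∀ x, 0 ≤ wt x) (K : ℝ) (hK : 0 ≤ K)
    (hex : ∀ k ≤ n, ∀ x y, wt x * wt y ≤ K * (wt (hybrid k x y) * wt (hybrid k y x)))
    (f : (Fin n → S) → ℝ) :
    ∑ p : (Fin n → S) × (Fin n → S), wt p.1 * wt p.2 * (f p.1 - f p.2) ^ 2 ≤
      n * K * (∑ x, wt x) * ∑ k : Fin n, ∑ z, ∑ a,
        min (wt z) (wt (Function.update z k a)) * (f z - f (Function.update z k a)) ^ 2 := by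
  have hpath : ∀ x y : Fin n → S, (f x - f y) ^ 2 ≤
      n * ∑ k : Fin n, (f (hybrid k x y) - f (hybrid (k + 1) x y)) ^ 2 := by
    intro x y
    have htel : ∑ k : Fin n, (f (hybrid k x y) - f (hybrid (k + 1) x y)) = f x - f y := by
      rw [Fin.sum_univ_eq_sum_range (fun k => f (hybrid k x y) - f (hybrid (k + 1) x y)),
        Finset.sum_range_sub', hybrid_zero, hybrid_self]
    rw [← htel]
    simpa using sq_sum_le_card_mul_sum_sq (s := Finset.univ)
      (f := fun k : Fin n => f (hybrid k x y) - f (hybrid (k + 1) x y))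
  have hslot : ∀ k : Fin n, ∑ p : (Fin n → S) × (Fin n → S),
      wt p.1 * wt p.2 * (f (hybrid k p.1 p.2) - f (hybrid (k + 1) p.1 p.2)) ^ 2 ≤
      K * (∑ x, wt x) * ∑ z, ∑ a,
        min (wt z) (wt (Function.update z k a)) * (f z - f (Function.update z k a)) ^ 2 := by
    intro k
    let c : (Fin n → S) → S → ℝ := fun z a =>
      min (wt z) (wt (Function.update z k a)) * (f z - f (Function.update z k a)) ^ 2
    have hc : ∀ z a, 0 ≤ c z a := fun z a =>
      mul_nonneg (le_min (hwt _) (hwt _)) (sq_nonneg _)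
    let e : (Fin n → S) → (Fin n → S) → ℝ := fun z w =>
      if wt z ≤ wt (Function.update z k (w k)) then wt w else wt (Function.update w k (z k))
    calc _ ≤ ∑ p : (Fin n → S) × (Fin n → S), K * (c (exchange k p).1 ((exchange k p).2 k) *
          e (exchange k p).1 (exchange k p).2) := by
          refine Finset.sum_le_sum fun p _ => ?_
          have h1 := hex k k.2.le p.1 p.2
          have h2 := hex (k + 1) k.2 p.1 p.2
          rw [hybrid_succ, hybrid_succ] at h2
          rw [hybrid_succ]
          change _ ≤ K * (c (hybrid k p.1 p.2) (hybrid k p.2 p.1 k) *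
            e (hybrid k p.1 p.2) (hybrid k p.2 p.1))
          generalize hybrid k p.1 p.2 = z at *
          generalize hybrid k p.2 p.1 = w at *
          simp only [c, e]
          split_ifs with h
          · rw [min_eq_left h]
            calc _ ≤ K * (wt z * wt w) * (f z - f (Function.update z k (w k))) ^ 2 :=
                  mul_le_mul_of_nonneg_right h1 (sq_nonneg _)
              _ = _ := by ring
          · rw [min_eq_right (not_le.1 h).le]
            calc _ ≤ K * (wt (Function.update z k (w k)) * wt (Function.update w k (z k))) *
                  (f z - f (Function.update z k (w k))) ^ 2 :=
                  mul_le_mul_of_nonneg_right h2 (sq_nonneg _)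
              _ = _ := by ring
      _ = ∑ p : (Fin n → S) × (Fin n → S), K * (c p.1 (p.2 k) * e p.1 p.2) :=
          Equiv.sum_comp (exchange (k : ℕ)) fun p => K * (c p.1 (p.2 k) * e p.1 p.2)
      _ = K * ∑ z, ∑ a, ∑ w with w k = a, c z (w k) * e z w := by
          rw [← Finset.mul_sum, Fintype.sum_prod_type]
          congr 1
          refine Finset.sum_congr rfl fun z _ => ?_
          exact (Finset.sum_fiberwise Finset.univ (fun w : Fin n → S => w k) _).symm
      _ ≤ K * ∑ z, ∑ a, c z a * ∑ x, wt x := by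
          refine mul_le_mul_of_nonneg_left (Finset.sum_le_sum fun z _ =>
            Finset.sum_le_sum fun a _ => ?_) hK
          have : ∑ w with w k = a, c z (w k) * e z w = c z a * ∑ w with w k = a,
              (if wt z ≤ wt (Function.update z k a) then wt w
                else wt (Function.update w k (z k))) := by
            rw [Finset.mul_sum]
            refine Finset.sum_congr rfl fun w hw => ?_
            rw [← (Finset.mem_filter.1 hw).2]
          rw [this]
          refine mul_le_mul_of_nonneg_left ?_ (hc z a)
          split_ifs
          · exact Finset.sum_le_sum_of_subset_of_nonneg (Finset.subset_univ _) fun x _ _ => hwt x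
          · exact sum_update_le wt hwt k a (z k)
      _ = _ := by
          simp only [← Finset.sum_mul]
          ring
  calc _ ≤ ∑ p : (Fin n → S) × (Fin n → S), n * ∑ k : Fin n, wt p.1 * wt p.2 *
        (f (hybrid k p.1 p.2) - f (hybrid (k + 1) p.1 p.2)) ^ 2 := by
        refine Finset.sum_le_sum fun p _ => ?_
        refine (mul_le_mul_of_nonneg_left (hpath p.1 p.2)
          (mul_nonneg (hwt _) (hwt _))).trans_eq ?_
        rw [← Finset.mul_sum]
        ring
    _ = n * ∑ k : Fin n, ∑ p : (Fin n → S) × (Fin n → S), wt p.1 * wt p.2 *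
        (f (hybrid k p.1 p.2) - f (hybrid (k + 1) p.1 p.2)) ^ 2 := by
        rw [← Finset.mul_sum, Finset.sum_comm]
    _ ≤ n * ∑ k : Fin n, (K * (∑ x, wt x) * ∑ z, ∑ a,
        min (wt z) (wt (Function.update z k a)) * (f z - f (Function.update z k a)) ^ 2) :=
        mul_le_mul_of_nonneg_left (Finset.sum_le_sum fun k _ => hslot k) (Nat.cast_nonneg n)
    _ = _ := by
        rw [← Finset.mul_sum]
        ring

/-- Summing a nonnegative function over single-slot updates counts each neighbour once. -/
lemma sum_update_le_sum_neighbor (g : (Fin n → S) → (Fin n → S) → ℝ) (hg : ∀ x y, 0 ≤ g x y)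
    (hg0 : ∀ x, g x x = 0) (z : Fin n → S) [DecidablePred fun y : Fin n → S =>
      z ≠ y ∧ ∃ k, ∀ j, j ≠ k → z j = y j] :
    ∑ k : Fin n, ∑ a, g z (Function.update z k a) ≤
      ∑ y, if z ≠ y ∧ ∃ k, ∀ j, j ≠ k → z j = y j then g z y else 0 := by
  rw [← Finset.sum_filter, ← Fintype.sum_prod_type' (f := fun k a => g z (Function.update z k a)),
    ← Finset.sum_filter_of_ne (p := fun q : Fin n × S => q.2 ≠ z q.1)]
  · have hinj : Set.InjOn (fun q : Fin n × S => Function.update z q.1 q.2)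
        (Finset.univ.filter fun q : Fin n × S => q.2 ≠ z q.1) := by
      intro q hq q' hq' h
      have hq := (Finset.mem_filter.1 hq).2
      have h1 : q.1 = q'.1 := by
        by_contra hne
        have := congrFun h q.1
        simp only [Function.update_self, Function.update_of_ne hne] at this
        exact hq this
      have h2 := congrFun h q.1
      simp only [Function.update_self] at h2
      rw [h1, Function.update_self] at h2
      exact Prod.ext h1 h2
    rw [← Finset.sum_image (f := g z) hinj]
    refine Finset.sum_le_sum_of_subset_of_nonneg ?_ fun y _ _ => hg z y
    intro y hy
    obtain ⟨q, hq, rfl⟩ := Finset.mem_image.1 hy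
    have hq := (Finset.mem_filter.1 hq).2
    refine Finset.mem_filter.2 ⟨Finset.mem_univ _, fun h => hq ?_, q.1, fun j hj => ?_⟩
    · have := congrFun h q.1
      simpa using this.symm
    · simp [hj]
  · rintro q - hne rfl'
    exact hne (by rw [rfl', Function.update_eq_self, hg0])

end Canonical

/-- A Poincaré inequality for a reversible kernel with jump rates `D` bounds its eigenvalues. -/
lemma one_le_mul_one_sub_eigenvalue {Ω : Type*} [Fintype Ω] (wt : Ω → ℝ) (hwt : ∀ x, 0 < wt x)
    (D : Ω → Ω → ℝ) (hD : ∀ x y, wt x * D x y = wt y * D y x) (f : Ω → ℝ) (lam R : ℝ)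
    (hf : f ≠ 0) (hmean : ∑ x, wt x * f x = 0)
    (hlam : ∀ x, ∑ y, D x y * (f x - f y) = (1 - lam) * f x)
    (hR : ∑ p : Ω × Ω, wt p.1 * wt p.2 * (f p.1 - f p.2) ^ 2 ≤
      R * (∑ x, wt x) * ∑ x, ∑ y, wt x * D x y * (f x - f y) ^ 2) :
    1 ≤ R * (1 - lam) := by
  obtain ⟨x₀, hx₀⟩ := Function.ne_iff.1 hf
  have hZ : 0 < ∑ x, wt x := Finset.sum_pos (fun x _ => hwt x) ⟨x₀, Finset.mem_univ _⟩
  have hS : 0 < ∑ x, wt x * f x ^ 2 :=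
    Finset.sum_pos' (fun x _ => mul_nonneg (hwt x).le (sq_nonneg _))
      ⟨x₀, Finset.mem_univ _, mul_pos (hwt _) (sq_pos_of_ne_zero hx₀)⟩
  have hvar : ∑ p : Ω × Ω, wt p.1 * wt p.2 * (f p.1 - f p.2) ^ 2 =
      2 * ((∑ x, wt x) * ∑ x, wt x * f x ^ 2) := by
    have h1 : ∀ x, ∑ y, wt x * wt y * (f x - f y) ^ 2 =
        wt x * f x ^ 2 * (∑ y, wt y) - 2 * (wt x * f x) * (∑ y, wt y * f y) +
          wt x * ∑ y, wt y * f y ^ 2 := by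
      intro x
      rw [Finset.mul_sum, Finset.mul_sum, Finset.mul_sum, ← Finset.sum_sub_distrib,
        ← Finset.sum_add_distrib]
      exact Finset.sum_congr rfl fun y _ => by ring
    rw [Fintype.sum_prod_type]
    simp only [h1, hmean, mul_zero, sub_zero, Finset.sum_add_distrib, ← Finset.sum_mul]
    ring
  have hdir : ∑ x, ∑ y, wt x * D x y * (f x - f y) ^ 2 =
      2 * ((1 - lam) * ∑ x, wt x * f x ^ 2) := by
    have h1 : ∑ x, ∑ y, wt x * D x y * (f x * (f x - f y)) =
        (1 - lam) * ∑ x, wt x * f x ^ 2 := by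
      rw [Finset.mul_sum]
      refine Finset.sum_congr rfl fun x _ => ?_
      calc _ = wt x * f x * ∑ y, D x y * (f x - f y) := by
            rw [Finset.mul_sum]
            exact Finset.sum_congr rfl fun y _ => by ring
        _ = _ := by rw [hlam]; ring
    have h2 : ∑ x, ∑ y, wt x * D x y * (f y * (f y - f x)) =
        (1 - lam) * ∑ x, wt x * f x ^ 2 := by
      rw [Finset.sum_comm, ← h1]
      exact Finset.sum_congr rfl fun x _ => Finset.sum_congr rfl fun y _ => by rw [hD]
    rw [two_mul]
    nth_rewrite 1 [← h1]
    rw [← h2]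
    simp only [← Finset.sum_add_distrib]
    exact Finset.sum_congr rfl fun x _ => Finset.sum_congr rfl fun y _ => by ring
  rw [hvar, hdir] at hR
  have hpos : 0 < 2 * ((∑ x, wt x) * ∑ x, wt x * f x ^ 2) := by positivity
  refine le_of_mul_le_mul_right ?_ hpos
  linarith

lemma confWt_pos {V : Type*} {E EF O : Finset (Finset V)} {B : ℕ} {T : {e : Finset V // e ∈ O} → ℝ}
    (hT : ∀ o, 0 < T o) (x : Fin (2 * B) → {e : Finset V // e ∈ O}) :
    0 < confWt E EF O B T x :=
  mul_pos (by positivity) (Finset.prod_pos fun k _ => hT _)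

lemma confWt_mul_offDiag {V : Type*} [DecidableEq V] {E EF O : Finset (Finset V)} {B : ℕ}
    {T : {e : Finset V // e ∈ O} → ℝ} (hT : ∀ o, 0 < T o)
    (x y : Fin (2 * B) → {e : Finset V // e ∈ O}) :
    confWt E EF O B T x * offDiag E EF O B T x y =
      if x ≠ y ∧ ∃ k, ∀ j, j ≠ k → x j = y j then
        (1 / (2 * B * O.card)) * min (confWt E EF O B T x) (confWt E EF O B T y) else 0 := by
  have hx := confWt_pos (E := E) (EF := EF) hT x
  have hZ : 0 < ∑ y : Fin (2 * B) → {e : Finset V // e ∈ O}, confWt E EF O B T y :=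
    Finset.sum_pos (fun x _ => confWt_pos hT x) ⟨x, Finset.mem_univ _⟩
  unfold offDiag
  split_ifs
  · rw [piDist, piDist, div_div_div_cancel_right₀ hZ.ne', mul_left_comm,
      mul_min_of_nonneg _ _ hx.le, mul_one, mul_div_cancel₀ _ hx.ne']
  · exact mul_zero _

lemma confWt_mul_offDiag_comm {V : Type*} [DecidableEq V] {E EF O : Finset (Finset V)} {B : ℕ}
    {T : {e : Finset V // e ∈ O} → ℝ} (hT : ∀ o, 0 < T o)
    (x y : Fin (2 * B) → {e : Finset V // e ∈ O}) :
    confWt E EF O B T x * offDiag E EF O B T x y =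
      confWt E EF O B T y * offDiag E EF O B T y x := by
  rw [confWt_mul_offDiag hT, confWt_mul_offDiag hT, min_comm]
  simp only [ne_comm (a := x), eq_comm (a := x _)]

lemma sum_offDiag_mul_sub {V : Type*} [DecidableEq V] {E EF O : Finset (Finset V)} {B : ℕ}
    {T : {e : Finset V // e ∈ O} → ℝ} {f : (Fin (2 * B) → {e : Finset V // e ∈ O}) → ℝ} {lam : ℝ}
    (h : ∀ x, ∑ y, transP E EF O B T x y * f y = lam * f x)
    (x : Fin (2 * B) → {e : Finset V // e ∈ O}) :
    ∑ y, offDiag E EF O B T x y * (f x - f y) = (1 - lam) * f x := by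
  have h1 : ∀ y, transP E EF O B T x y * f y = offDiag E EF O B T x y * f y +
      if x = y then (1 - ∑ y', offDiag E EF O B T x y') * f y else 0 := by
    intro y
    unfold transP
    split_ifs with hxy
    · subst hxy
      simp [offDiag]
    · simp
  have h2 := h x
  simp only [h1, Finset.sum_add_distrib, Finset.sum_ite_eq, Finset.mem_univ, if_true] at h2
  simp only [mul_sub, Finset.sum_sub_distrib, ← Finset.sum_mul]
  linarith

lemma confWt_mul_le {A : Finset V} {E EF O : Finset (Finset V)} {B : ℕ}
    (hE : ∀ e ∈ E, ∃ i j : V, i ∈ A ∧ j ∉ A ∧ e = {i, j})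
    (hEF : ∀ e ∈ EF, ∃ i j : V, i ≠ j ∧ ((i ∈ A ∧ j ∈ A) ∨ (i ∉ A ∧ j ∉ A)) ∧ e = {i, j})
    {T : {e : Finset V // e ∈ O} → ℝ} (hT : ∀ o, 0 < T o) (k : ℕ) (hk : k ≤ 2 * B)
    (x y : Fin (2 * B) → {e : Finset V // e ∈ O}) :
    confWt E EF O B T x * confWt E EF O B T y ≤ 2 ^ (4 * A.card) *
      (confWt E EF O B T (hybrid k x y) * confWt E EF O B T (hybrid k y x)) := by
  have hL := numLoops_add_le hE hEF (fun t => (x t : Finset V)) (fun t => (y t : Finset V)) k hk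
  have hyb : ∀ u v : Fin (2 * B) → {e : Finset V // e ∈ O},
      hybrid k (fun t => (u t : Finset V)) (fun t => (v t : Finset V)) =
        fun t => (hybrid k u v t).1 := by
    intro u v
    ext1 t
    unfold hybrid
    split_ifs <;> rfl
  rw [hyb, hyb] at hL
  have hprod : (∏ t, T (x t)) * ∏ t, T (y t) =
      (∏ t, T (hybrid k x y t)) * ∏ t, T (hybrid k y x t) := by
    rw [← Finset.prod_mul_distrib, ← Finset.prod_mul_distrib]
    refine Finset.prod_congr rfl fun t _ => ?_
    unfold hybrid
    split_ifs
    · exact mul_comm _ _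
    · rfl
  unfold confWt
  rw [mul_mul_mul_comm, hprod, mul_mul_mul_comm (2 ^ _) (∏ t, T (hybrid k x y t)),
    ← mul_assoc (2 ^ (4 * A.card)), ← pow_add, ← pow_add, ← pow_add]
  refine mul_le_mul_of_nonneg_right (pow_le_pow_right₀ one_le_two (by omega)) ?_
  exact mul_nonneg (Finset.prod_nonneg fun t _ => (hT _).le)
    (Finset.prod_nonneg fun t _ => (hT _).le)

/-- The spectral gap of the SPE Metropolis chain is at least
`(12 B² N (T_max/T_min) 2^{8|𝒜|−4})⁻¹`: every eigenvalue of `P` whose eigenfunction is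
`π`-orthogonal to the constants (i.e. every eigenvalue other than the top eigenvalue `1`)
is at most `1 − (12 B² N (T_max/T_min) 2^{8|𝒜|−4})⁻¹`. -/
theorem spectral_gap
    (A : Finset V) (E EF : Finset (Finset V)) (VX : Finset V)
    (hE : ∀ e ∈ E, ∃ i j : V, i ∈ A ∧ j ∉ A ∧ e = {i, j})
    (hEF : ∀ e ∈ EF, ∃ i j : V, i ≠ j ∧ ((i ∈ A ∧ j ∈ A) ∨ (i ∉ A ∧ j ∉ A)) ∧ e = {i, j})
    (hA : 1 ≤ A.card) (hAB : A.card ≤ Aᶜ.card)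
    (B : ℕ) (hB : 0 < B)
    (O : Finset (Finset V))
    (hO : O = E ∪ EF ∪ VX.image (fun i => ({i} : Finset V)))
    (hOcard : O.card ≤ 3 * Fintype.card V)
    (T : {e : Finset V // e ∈ O} → ℝ) (hT : ∀ o, 0 < T o)
    (Tmax Tmin : ℝ)
    (hTmax : (∀ o, T o ≤ Tmax) ∧ ∃ o, T o = Tmax)
    (hTmin : (∀ o, Tmin ≤ T o) ∧ ∃ o, T o = Tmin) :
    ∀ (f : (Fin (2 * B) → {e : Finset V // e ∈ O}) → ℝ) (lam : ℝ),
      f ≠ 0 →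
      (∑ x, piDist E EF O B T x * f x) = 0 →
      (∀ x, ∑ y, transP E EF O B T x y * f y = lam * f x) →
      lam ≤ 1 - (12 * (B : ℝ) ^ 2 * (Fintype.card V) * (Tmax / Tmin) *
        2 ^ (8 * A.card - 4))⁻¹ := by
  intro f lam hf hmean heig
  obtain ⟨o, ho⟩ := hTmax.2
  have hOpos : 0 < O.card := Finset.card_pos.2 ⟨o.1, o.2⟩
  have hwt := confWt_pos (E := E) (EF := EF) (B := B) hT
  have hZ : 0 < ∑ y : Fin (2 * B) → {e : Finset V // e ∈ O}, confWt E EF O B T y :=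
    Finset.sum_pos (fun x _ => hwt x) ⟨fun _ => o, Finset.mem_univ _⟩
  have hBpos : (0 : ℝ) < B := Nat.cast_pos.2 hB
  have hOpos' : (0 : ℝ) < O.card := Nat.cast_pos.2 hOpos
  have hmean' : ∑ x, confWt E EF O B T x * f x = 0 := by
    simp only [piDist, div_mul_eq_mul_div, ← Finset.sum_div] at hmean
    exact (div_eq_zero_iff.1 hmean).resolve_right hZ.ne'
  have hedges : ∀ z, ∑ k : Fin (2 * B), ∑ a,
      min (confWt E EF O B T z) (confWt E EF O B T (Function.update z k a)) *
        (f z - f (Function.update z k a)) ^ 2 ≤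
      2 * B * O.card * ∑ y, confWt E EF O B T z * offDiag E EF O B T z y * (f z - f y) ^ 2 := by
    intro z
    refine (sum_update_le_sum_neighbor
      (fun z y => min (confWt E EF O B T z) (confWt E EF O B T y) * (f z - f y) ^ 2)
      (fun x y => mul_nonneg (le_min (hwt x).le (hwt y).le) (sq_nonneg _))
      (fun x => by simp) z).trans_eq ?_
    rw [Finset.mul_sum]
    refine Finset.sum_congr rfl fun y _ => ?_
    rw [confWt_mul_offDiag hT]
    split_ifs
    · field_simp
    · simp
  have hpath := canonical_path_bound (confWt E EF O B T) (fun x => (hwt x).le)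
    (2 ^ (4 * A.card)) (by positivity) (confWt_mul_le hE hEF hT) f
  have hgap := one_le_mul_one_sub_eigenvalue (confWt E EF O B T) hwt (offDiag E EF O B T)
    (confWt_mul_offDiag_comm hT) f lam (4 * B ^ 2 * O.card * 2 ^ (4 * A.card)) hf hmean'
    (sum_offDiag_mul_sub heig) <| hpath.trans <| by
      rw [Finset.sum_comm]
      refine (mul_le_mul_of_nonneg_left (Finset.sum_le_sum fun z _ => hedges z)
        (by positivity)).trans_eq ?_
      rw [← Finset.mul_sum]
      push_cast
      ring
  have hTminpos : 0 < Tmin := by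
    obtain ⟨o', ho'⟩ := hTmin.2
    exact ho' ▸ hT o'
  have hratio : 1 ≤ Tmax / Tmin := (one_le_div hTminpos).2 (ho ▸ hTmin.1 o)
  have hOle : (O.card : ℝ) ≤ 3 * Fintype.card V := by exact_mod_cast hOcard
  have hconst : 4 * (B : ℝ) ^ 2 * O.card * 2 ^ (4 * A.card) ≤
      12 * (B : ℝ) ^ 2 * (Fintype.card V) * (Tmax / Tmin) * 2 ^ (8 * A.card - 4) := by
    have hpow : (2 : ℝ) ^ (4 * A.card) ≤ 2 ^ (8 * A.card - 4) :=
      pow_le_pow_right₀ one_le_two (by omega)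
    refine mul_le_mul ?_ hpow (by positivity) (by positivity)
    calc 4 * (B : ℝ) ^ 2 * O.card ≤ 4 * (B : ℝ) ^ 2 * (3 * Fintype.card V) := by gcongr
      _ = 12 * (B : ℝ) ^ 2 * (Fintype.card V) * 1 := by ring
      _ ≤ _ := by gcongr
  have hRpos : 0 < 4 * (B : ℝ) ^ 2 * O.card * 2 ^ (4 * A.card) := by positivity
  have hinv := inv_anti₀ hRpos hconst
  have hone : (4 * (B : ℝ) ^ 2 * O.card * 2 ^ (4 * A.card))⁻¹ ≤ 1 - lam :=
    (inv_le_iff_one_le_mul₀' hRpos).2 hgap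
  linarith
end
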